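/- arXiv:2603.09475 — 7 statements merged into one kernel-verified Lean document; each statement's English description precedes it below -/
import Mathlib

section
/- Theorem 3 (characterization for grids): Let p, q ≥ 1, let G = P_p □ P_q be the grid, and let T ⊆ V(G) satisfy condition P. Then G admits an acyclic T-odd orientation if and only if (G,T) is not a bad grid instance. -/
open SimpleGraph

section Defs

variable {V : Type*}

/-- An orientation of a simple graph: each edge gets exactly one direction. -/
structure GraphOrientation {V : Type*} (G : SimpleGraph V) where
  dir : V → V → Prop
  dir_adj : ∀ u v, dir u v → G.Adj u v
  dir_choice : ∀ u v, G.Adj u v → (dir u v ↔ ¬ dir v u)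

/-- An orientation is acyclic if there is no directed cycle, i.e. the transitive
closure of the arc relation is irreflexive. -/
def GraphOrientation.Acyclic {G : SimpleGraph V} (o : GraphOrientation G) : Prop :=
  Irreflexive (Relation.TransGen o.dir)

/-- In-degree of a vertex in an orientation. -/
noncomputable def GraphOrientation.indeg {G : SimpleGraph V} (o : GraphOrientation G)
    (v : V) : ℕ :=
  Set.ncard {u | o.dir u v}

/-- An orientation is `T`-odd if a vertex has odd in-degree iff it belongs to `T`. -/
def GraphOrientation.IsTOdd {G : SimpleGraph V} (o : GraphOrientation G) (T : Set V) : Prop :=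
  ∀ v, Odd (o.indeg v) ↔ v ∈ T

/-- `G` admits an acyclic `T`-odd orientation. -/
def HasAcyclicTOddOrientation (G : SimpleGraph V) (T : Set V) : Prop :=
  ∃ o : GraphOrientation G, o.Acyclic ∧ o.IsTOdd T

/-- Degree of a vertex. -/
noncomputable def vdeg (G : SimpleGraph V) (v : V) : ℕ := (G.neighborSet v).ncard

/-- Potential sources: `V \ T`. -/
def sourceSet (T : Set V) : Set V := Tᶜ

/-- Potential sinks. -/
def sinkSet (G : SimpleGraph V) (T : Set V) : Set V :=
  {v | (v ∈ T ∧ Odd (vdeg G v)) ∨ (v ∉ T ∧ Even (vdeg G v))}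

/-- Parity condition `𝒫`: `|E| + |T|` is even. -/
def CondP (G : SimpleGraph V) (T : Set V) : Prop :=
  Even (G.edgeSet.ncard + T.ncard)

/-- Source condition `𝒮`. -/
def CondS (G : SimpleGraph V) (T : Set V) : Prop :=
  (sourceSet T).Nonempty ∧
    ((sourceSet T).ncard = 1 → Nat.card V = 1 ∨ sourceSet T ≠ sinkSet G T)

/-- Sink condition `𝒮̄`. -/
def CondSbar (G : SimpleGraph V) (T : Set V) : Prop :=
  (sinkSet G T).Nonempty ∧
    ((sinkSet G T).ncard = 1 → Nat.card V = 1 ∨ sinkSet G T ≠ sourceSet T)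

/-- Membership in the class `C_P`. -/
def MemCP (G : SimpleGraph V) : Prop :=
  ∀ T : Set V, CondP G T → HasAcyclicTOddOrientation G T

/-- Membership in the class `C_{P,S}`. -/
def MemCPS (G : SimpleGraph V) : Prop :=
  ∀ T : Set V, CondP G T → CondS G T → HasAcyclicTOddOrientation G T

/-- Membership in the class `C_{P,S̄}`. -/
def MemCPSbar (G : SimpleGraph V) : Prop :=
  ∀ T : Set V, CondP G T → CondSbar G T → HasAcyclicTOddOrientation G T

/-- Membership in the class `C_{P,S,S̄}`. -/
def MemCPSSbar (G : SimpleGraph V) : Prop :=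
  ∀ T : Set V, CondP G T → CondS G T → CondSbar G T → HasAcyclicTOddOrientation G T

/-- A graph is Eulerian if it is connected and every vertex has even degree. -/
def IsEulerianGraph (G : SimpleGraph V) : Prop :=
  G.Connected ∧ ∀ v : V, Even (vdeg G v)

end Defs

section BadGrid

/-- A path instance on vertices `w_0, …, w_{h-1}` (membership in `T` given by `inT`)
is a *bad path instance*. -/
def BadPathInstance (h : ℕ) (inT : ℕ → Prop) : Prop :=
  Even h ∧ inT 0 ∧ inT (h - 1) ∧
    ∀ k : ℕ, 1 ≤ k → k ≤ (h - 2) / 2 → (inT (2 * k - 1) ↔ inT (2 * k))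

/-- Trace of `T` on the boundary row `j = 0` of the grid `P_p □ P_q`. -/
def gridRow0 (p q : ℕ) (T : Set (Fin p × Fin q)) : ℕ → Prop :=
  fun i => ∃ (hi : i < p) (hj : 0 < q), (⟨i, hi⟩, ⟨0, hj⟩) ∈ T

/-- Trace of `T` on the boundary row `j = q - 1` of the grid `P_p □ P_q`. -/
def gridRowLast (p q : ℕ) (T : Set (Fin p × Fin q)) : ℕ → Prop :=
  fun i => ∃ (hi : i < p) (hj : q - 1 < q), (⟨i, hi⟩, ⟨q - 1, hj⟩) ∈ T

/-- Trace of `T` on the boundary column `i = 0` of the grid `P_p □ P_q`. -/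
def gridCol0 (p q : ℕ) (T : Set (Fin p × Fin q)) : ℕ → Prop :=
  fun j => ∃ (hi : 0 < p) (hj : j < q), (⟨0, hi⟩, ⟨j, hj⟩) ∈ T

/-- Trace of `T` on the boundary column `i = p - 1` of the grid `P_p □ P_q`. -/
def gridColLast (p q : ℕ) (T : Set (Fin p × Fin q)) : ℕ → Prop :=
  fun j => ∃ (hi : p - 1 < p) (hj : j < q), (⟨p - 1, hi⟩, ⟨j, hj⟩) ∈ T

/-- `(P_p □ P_q, T)` is a *bad grid instance*. -/
def BadGridInstance (p q : ℕ) (T : Set (Fin p × Fin q)) : Prop :=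
  Even p ∧ Even q ∧
  (∀ (i : Fin p) (j : Fin q), 1 ≤ (i : ℕ) → (i : ℕ) ≤ p - 2 →
      1 ≤ (j : ℕ) → (j : ℕ) ≤ q - 2 → (i, j) ∈ T) ∧
  BadPathInstance p (gridRow0 p q T) ∧
  BadPathInstance p (gridRowLast p q T) ∧
  BadPathInstance q (gridCol0 p q T) ∧
  BadPathInstance q (gridColLast p q T)

end BadGrid


section ParityOrder

variable {V : Type*}

/-- The vertices of `S` can be ranked injectively so that every vertex of `S`, with at most one
exception, has a number of lower-ranked neighbours in `S` congruent to its label modulo `2`. -/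
def HasParityOrder (G : SimpleGraph V) [DecidableRel G.Adj] (S : Finset V) (T : V → ZMod 2) :
    Prop :=
  ∃ r : V → ℤ, Set.InjOn r S ∧ ∃ w, ∀ v ∈ S, v ≠ w →
    ((S.filter fun u => G.Adj v u ∧ r u < r v).card : ZMod 2) = T v

/-- Every labelling whose sum over `L` equals `c` has a parity order on `S`. -/
def HasParityOrderIf (G : SimpleGraph V) [DecidableRel G.Adj] (S L : Finset V) (c : ZMod 2) :
    Prop :=
  ∀ T : V → ZMod 2, ∑ x ∈ L, T x = c → HasParityOrder G S T

variable {G : SimpleGraph V} [DecidableRel G.Adj] {S L : Finset V} {T : V → ZMod 2} {v : V}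
  {c : ZMod 2}

theorem sum_add_ite_adj (G : SimpleGraph V) [DecidableRel G.Adj] (L : Finset V)
    (T : V → ZMod 2) (v : V) :
    ∑ x ∈ L, (T x + if G.Adj v x then 1 else 0) =
      ∑ x ∈ L, T x + ((L.filter (G.Adj v)).card : ZMod 2) := by
  rw [Finset.sum_add_distrib, Finset.sum_boole]

theorem hasParityOrderIf_singleton (v : V) : HasParityOrderIf G {v} ∅ 0 :=
  fun _ _ => ⟨fun _ => 0, by simp, v, fun x hx hne => absurd (Finset.mem_singleton.1 hx) hne⟩

theorem HasParityOrderIf.of_empty (h : HasParityOrderIf G S ∅ 0) : HasParityOrderIf G S L c :=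
  fun T _ => h T Finset.sum_empty

theorem HasParityOrder.map_equiv (e : G ≃g G) (h : HasParityOrder G S (T ∘ e)) :
    HasParityOrder G (S.map e.toEquiv.toEmbedding) T := by
  obtain ⟨r, hr, w, hw⟩ := h
  refine ⟨r ∘ e.symm, ?_, e w, ?_⟩
  · rintro x hx y hy hxy
    simp only [Finset.coe_map, Set.mem_image, Finset.mem_coe] at hx hy
    obtain ⟨x, hx, rfl⟩ := hx
    obtain ⟨y, hy, rfl⟩ := hy
    have : r x = r y := by simpa using hxy
    rw [hr hx hy this]
  · intro x hx hxw
    rw [Finset.mem_map] at hx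
    obtain ⟨x, hx, rfl⟩ := hx
    rw [Finset.filter_map, Finset.card_map]
    have := hw x hx (fun h' => hxw (by rw [h']; rfl))
    simp only [Function.comp_apply] at this
    simpa [Function.comp_def, e.map_adj_iff] using this

variable [DecidableEq V]

theorem HasParityOrder.insert_sink (hv : v ∉ S)
    (hd : ((S.filter (G.Adj v)).card : ZMod 2) = T v) (h : HasParityOrder G S T) :
    HasParityOrder G (insert v S) T := by
  obtain ⟨r, hr, w, hw⟩ := h
  obtain ⟨M, hM⟩ := (S.image r).bddAbove
  have hM' : ∀ x ∈ S, r x < M + 1 := fun x hx =>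
    Int.lt_add_one_of_le (hM (Finset.mem_coe.2 (Finset.mem_image_of_mem r hx)))
  have hne : ∀ x ∈ S, x ≠ v := fun x hx e => hv (e ▸ hx)
  have hup : ∀ x ∈ S, Function.update r v (M + 1) x = r x := fun x hx =>
    Function.update_of_ne (hne x hx) _ _
  refine ⟨Function.update r v (M + 1), ?_, w, ?_⟩
  · rw [Finset.coe_insert, Set.injOn_insert (by simpa using hv)]
    refine ⟨fun x hx y hy hxy => hr hx hy ?_, ?_⟩
    · rwa [hup x hx, hup y hy] at hxy
    · rintro ⟨x, hx, hxv⟩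
      rw [hup x hx, Function.update_self] at hxv
      exact (hM' x hx).ne hxv
  · intro x hxv hxw
    obtain rfl | hx := Finset.mem_insert.1 hxv
    · rw [← hd]
      congr 2
      ext u
      simp only [Finset.mem_filter, Finset.mem_insert, Function.update_self]
      constructor
      · rintro ⟨rfl | hu, ha, -⟩
        · exact absurd ha (G.irrefl)
        · exact ⟨hu, ha⟩
      · rintro ⟨hu, ha⟩
        exact ⟨.inr hu, ha, by rw [hup u hu]; exact hM' u hu⟩
    · rw [← hw x hx hxw]
      congr 2
      ext u
      simp only [Finset.mem_filter, Finset.mem_insert, hup x hx]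
      constructor
      · rintro ⟨rfl | hu, ha, hlt⟩
        · rw [Function.update_self] at hlt
          exact absurd (hM' x hx) hlt.not_gt
        · exact ⟨hu, ha, by rwa [hup u hu] at hlt⟩
      · rintro ⟨hu, ha, hlt⟩
        exact ⟨.inr hu, ha, by rwa [hup u hu]⟩

theorem HasParityOrder.insert_source (hv : v ∉ S) (hd : T v = 0)
    (h : HasParityOrder G S fun x => T x + if G.Adj v x then 1 else 0) :
    HasParityOrder G (insert v S) T := by
  obtain ⟨r, hr, w, hw⟩ := h
  obtain ⟨M, hM⟩ := (S.image r).bddBelow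
  have hM' : ∀ x ∈ S, M - 1 < r x := fun x hx =>
    Int.sub_one_lt_of_le (hM (Finset.mem_coe.2 (Finset.mem_image_of_mem r hx)))
  have hne : ∀ x ∈ S, x ≠ v := fun x hx e => hv (e ▸ hx)
  have hup : ∀ x ∈ S, Function.update r v (M - 1) x = r x := fun x hx =>
    Function.update_of_ne (hne x hx) _ _
  refine ⟨Function.update r v (M - 1), ?_, w, ?_⟩
  · rw [Finset.coe_insert, Set.injOn_insert (by simpa using hv)]
    refine ⟨fun x hx y hy hxy => hr hx hy ?_, ?_⟩
    · rwa [hup x hx, hup y hy] at hxy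
    · rintro ⟨x, hx, hxv⟩
      rw [hup x hx, Function.update_self] at hxv
      exact (hM' x hx).ne' hxv
  · intro x hxv hxw
    obtain rfl | hx := Finset.mem_insert.1 hxv
    · rw [hd, Finset.filter_false_of_mem, Finset.card_empty, Nat.cast_zero]
      rintro u hu ⟨ha, hlt⟩
      obtain rfl | hu := Finset.mem_insert.1 hu
      · exact G.irrefl ha
      · rw [hup u hu, Function.update_self] at hlt
        exact absurd (hM' u hu) hlt.not_gt
    · have hfilter : (S.filter fun u => G.Adj x u ∧
          Function.update r v (M - 1) u < Function.update r v (M - 1) x) =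
          S.filter fun u => G.Adj x u ∧ r u < r x :=
        Finset.filter_congr fun u hu => by rw [hup u hu, hup x hx]
      rw [Finset.filter_insert, hfilter, hup x hx, Function.update_self]
      have key := hw x hx hxw
      dsimp only at key
      by_cases ha : G.Adj v x
      · rw [if_pos ⟨ha.symm, hM' x hx⟩, Finset.card_insert_of_notMem (by simp [hv]),
          Nat.cast_succ, key, if_pos ha, add_assoc, CharTwo.add_self_eq_zero, add_zero]
      · rw [if_neg (fun h' => ha h'.1.symm), key, if_neg ha, add_zero]

/-- Inserting a vertex of odd degree with an even number of neighbours in `L`. -/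
theorem HasParityOrderIf.insert_odd (h : HasParityOrderIf G S L c) (hv : v ∉ S)
    (hd : Odd (S.filter (G.Adj v)).card) (hL : Even (L.filter (G.Adj v)).card) :
    HasParityOrderIf G (insert v S) L c := by
  intro T hT
  obtain h0 | h1 : T v = 0 ∨ T v = 1 := by generalize T v = a; revert a; decide
  · refine HasParityOrder.insert_source hv h0 (h _ ?_)
    rw [sum_add_ite_adj, hT, (ZMod.natCast_eq_zero_iff_even).2 hL, add_zero]
  · exact HasParityOrder.insert_sink hv (by rw [h1, ZMod.natCast_eq_one_iff_odd.2 hd]) (h _ hT)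

/-- Inserting a vertex of odd degree with an odd number of neighbours in `L`. -/
theorem HasParityOrderIf.insert_odd_odd (h : HasParityOrderIf G S L c) (hv : v ∉ S) (hvL : v ∉ L)
    (hd : Odd (S.filter (G.Adj v)).card) (hL : Odd (L.filter (G.Adj v)).card) :
    HasParityOrderIf G (insert v S) (insert v L) (c + 1) := by
  intro T hT
  rw [Finset.sum_insert hvL] at hT
  obtain h0 | h1 : T v = 0 ∨ T v = 1 := by generalize T v = a; revert a; decide
  · refine HasParityOrder.insert_source hv h0 (h _ ?_)
    rw [sum_add_ite_adj, (ZMod.natCast_eq_one_iff_odd).2 hL]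
    rw [h0, zero_add] at hT
    rw [hT, add_assoc, CharTwo.add_self_eq_zero, add_zero]
  · refine HasParityOrder.insert_sink hv (by rw [h1, ZMod.natCast_eq_one_iff_odd.2 hd]) (h _ ?_)
    rw [h1, add_comm] at hT
    exact add_right_cancel hT

/-- Inserting a vertex of even degree with an odd number of neighbours in `L`. -/
theorem HasParityOrderIf.insert_even (h : HasParityOrderIf G S L c) (hv : v ∉ S)
    (hd : Even (S.filter (G.Adj v)).card) (hL : Odd (L.filter (G.Adj v)).card) :
    HasParityOrderIf G (insert v S) {v} 0 := by
  intro T hT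
  rw [Finset.sum_singleton] at hT
  by_cases hc : ∑ x ∈ L, T x = c
  · exact HasParityOrder.insert_sink hv
      (by rw [hT, (ZMod.natCast_eq_zero_iff_even).2 hd]) (h _ hc)
  · refine HasParityOrder.insert_source hv hT (h _ ?_)
    rw [sum_add_ite_adj, (ZMod.natCast_eq_one_iff_odd).2 hL]
    revert hc
    generalize ∑ x ∈ L, T x = a
    clear h
    revert a c
    decide

end ParityOrder

section IntegerGrid

/-- The infinite square grid on `ℤ × ℤ`. -/
def integerGrid : SimpleGraph (ℤ × ℤ) where
  Adj u v := (u.1 = v.1 ∧ (u.2 = v.2 + 1 ∨ v.2 = u.2 + 1)) ∨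
    (u.2 = v.2 ∧ (u.1 = v.1 + 1 ∨ v.1 = u.1 + 1))
  symm := ⟨fun u v h => by omega⟩
  loopless := ⟨fun u h => by omega⟩

theorem integerGrid_adj (u v : ℤ × ℤ) : integerGrid.Adj u v ↔
    (u.1 = v.1 ∧ (u.2 = v.2 + 1 ∨ v.2 = u.2 + 1)) ∨
      (u.2 = v.2 ∧ (u.1 = v.1 + 1 ∨ v.1 = u.1 + 1)) :=
  Iff.rfl

instance : DecidableRel integerGrid.Adj := fun u v =>
  decidable_of_iff _ (integerGrid_adj u v).symm

theorem card_filter_integerGrid_adj (S : Finset (ℤ × ℤ)) (i j : ℤ) :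
    (S.filter (integerGrid.Adj (i, j))).card =
      (if (i + 1, j) ∈ S then 1 else 0) + (if (i - 1, j) ∈ S then 1 else 0) +
        ((if (i, j + 1) ∈ S then 1 else 0) + (if (i, j - 1) ∈ S then 1 else 0)) := by
  have h : S.filter (integerGrid.Adj (i, j)) =
      ({(i + 1, j), (i - 1, j), (i, j + 1), (i, j - 1)} : Finset (ℤ × ℤ)).filter (· ∈ S) := by
    ext ⟨a, b⟩
    simp only [Finset.mem_filter, integerGrid_adj, Finset.mem_insert, Finset.mem_singleton,
      Prod.mk.injEq]
    constructor
    · rintro ⟨hS, h⟩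
      exact ⟨by omega, hS⟩
    · rintro ⟨h, hS⟩
      exact ⟨hS, by omega⟩
  rw [h, Finset.card_filter, Finset.sum_insert, Finset.sum_insert, Finset.sum_insert,
    Finset.sum_singleton]
  · ring
  all_goals
    simp only [Finset.mem_insert, Finset.mem_singleton, Prod.mk.injEq]
    omega

variable {S L : Finset (ℤ × ℤ)} {c : ZMod 2}

/-- The rectangle of rows `a, …, b - 1` and columns `c, …, d - 1`. -/
noncomputable def gridBox (a b c d : ℤ) : Finset (ℤ × ℤ) := Finset.Ico a b ×ˢ Finset.Ico c d

theorem mem_gridBox {a b c d i j : ℤ} :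
    (i, j) ∈ gridBox a b c d ↔ (a ≤ i ∧ i < b) ∧ c ≤ j ∧ j < d := by
  simp [gridBox]

theorem odd_card_integerGrid {i j : ℤ} (n s e w : Bool)
    (h : (n ^^ s ^^ e ^^ w) = true := by rfl)
    (hn : (i - 1, j) ∈ S ↔ n := by grind [mem_gridBox])
    (hs : (i + 1, j) ∈ S ↔ s := by grind [mem_gridBox])
    (he : (i, j + 1) ∈ S ↔ e := by grind [mem_gridBox])
    (hw : (i, j - 1) ∈ S ↔ w := by grind [mem_gridBox]) :
    Odd (S.filter (integerGrid.Adj (i, j))).card := by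
  rw [card_filter_integerGrid_adj]
  simp only [hs, hn, he, hw]
  clear hs hn he hw
  revert n s e w
  decide

theorem even_card_integerGrid {i j : ℤ} (n s e w : Bool)
    (h : (n ^^ s ^^ e ^^ w) = false := by rfl)
    (hn : (i - 1, j) ∈ S ↔ n := by grind [mem_gridBox])
    (hs : (i + 1, j) ∈ S ↔ s := by grind [mem_gridBox])
    (he : (i, j + 1) ∈ S ↔ e := by grind [mem_gridBox])
    (hw : (i, j - 1) ∈ S ↔ w := by grind [mem_gridBox]) :
    Even (S.filter (integerGrid.Adj (i, j))).card := by
  rw [card_filter_integerGrid_adj]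
  simp only [hs, hn, he, hw]
  clear hs hn he hw
  revert n s e w
  decide

theorem even_card_integerGrid_of_forall {i j : ℤ}
    (h : ∀ x ∈ L, ¬ integerGrid.Adj (i, j) x) :
    Even (L.filter (integerGrid.Adj (i, j))).card := by
  rw [Finset.filter_false_of_mem h]
  exact Even.zero

/-- Two further rows can be put on top of the row `r + 2`. -/
theorem HasParityOrderIf.union_two_rows (h : HasParityOrderIf integerGrid S L c) {r k : ℤ} {n : ℕ}
    (hS : ∀ i j, (i, j) ∈ S → r + 2 ≤ i) (hL : ∀ i j, (i, j) ∈ L → r + 3 ≤ i)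
    (hrow : ∀ j, k ≤ j → j < k + n → (r + 2, j) ∈ S) :
    HasParityOrderIf integerGrid (S ∪ gridBox r (r + 2) k (k + n)) L c := by
  induction n with
  | zero => simpa [gridBox] using h
  | succ n ih =>
    have h₀ := ih fun j h₁ h₂ => hrow j h₁ (by push_cast; omega)
    have hr := hrow (k + n) (by omega) (by push_cast; omega)
    have hLe : ∀ i j, i ≤ r + 1 → Even (L.filter (integerGrid.Adj (i, j))).card := by
      refine fun i j hi => even_card_integerGrid_of_forall ?_
      rintro ⟨a, b⟩ hab hadj
      have := hL a b hab
      simp only [integerGrid_adj] at hadj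
      omega
    obtain rfl | hn := Nat.eq_zero_or_pos n
    · have h₁ := h₀.insert_odd (v := (r + 1, k)) (by grind [mem_gridBox])
        (odd_card_integerGrid false true false false)
        (hLe _ _ le_rfl)
      have h₂ := h₁.insert_odd (v := (r, k)) (by grind [mem_gridBox])
        (odd_card_integerGrid false true false false)
        (hLe _ _ (by omega))
      convert h₂ using 1
      ext ⟨i, j⟩
      grind [mem_gridBox]
    · have h₁ := h₀.insert_odd (v := (r, k + n)) (by grind [mem_gridBox])
        (odd_card_integerGrid false false false true)
        (hLe _ _ (by omega))
      have h₂ := h₁.insert_odd (v := (r + 1, k + n)) (by grind [mem_gridBox])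
        (odd_card_integerGrid true true false true)
        (hLe _ _ le_rfl)
      convert h₂ using 1
      ext ⟨i, j⟩
      grind [mem_gridBox]

theorem hasParityOrderIf_gridBox_odd_rows (a k : ℤ) (m n : ℕ) :
    HasParityOrderIf integerGrid (gridBox a (a + (2 * m + 1)) k (k + (n + 1))) ∅ 0 := by
  induction m generalizing a with
  | zero =>
    induction n with
    | zero =>
      have h := hasParityOrderIf_singleton (G := integerGrid) (a, k)
      convert h using 1
      ext ⟨i, j⟩
      grind [mem_gridBox]
    | succ n ih =>
      have h := ih.insert_odd (v := (a, k + (n + 1))) (by grind [mem_gridBox])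
        (odd_card_integerGrid false false false true) (by simp)
      convert h using 1
      ext ⟨i, j⟩
      grind [mem_gridBox]
  | succ m ih =>
    have h := (ih (a + 2)).union_two_rows (r := a) (k := k) (n := n + 1) (by grind [mem_gridBox])
      (by simp) (by grind [mem_gridBox])
    convert h using 1
    ext ⟨i, j⟩
    grind [mem_gridBox]

/-- Interchanging rows and columns. -/
def integerGridSwap : integerGrid ≃g integerGrid where
  toEquiv := Equiv.prodComm ℤ ℤ
  map_rel_iff' := by
    intro u v
    simp only [integerGrid_adj, Equiv.prodComm_apply, Prod.fst_swap, Prod.snd_swap]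
    tauto

/-- Reversing the order of the rows. -/
def integerGridFlip (p : ℤ) : integerGrid ≃g integerGrid where
  toEquiv := (Equiv.subLeft p).prodCongr (Equiv.refl ℤ)
  map_rel_iff' := by
    intro u v
    simp only [integerGrid_adj, Equiv.prodCongr_apply, Prod.map_fst, Prod.map_snd,
      Equiv.subLeft_apply, Equiv.refl_apply]
    omega

theorem HasParityOrder.of_swap {a b k l : ℤ} {T : ℤ × ℤ → ZMod 2}
    (h : HasParityOrder integerGrid (gridBox k l a b) fun x => T (x.2, x.1)) :
    HasParityOrder integerGrid (gridBox a b k l) T := by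
  convert HasParityOrder.map_equiv (T := T) integerGridSwap h using 1
  ext ⟨i, j⟩
  simp only [Finset.mem_map, Prod.exists]
  constructor
  · exact fun hx => ⟨j, i, by grind [mem_gridBox], rfl⟩
  · rintro ⟨x, y, hxy, h⟩
    obtain ⟨rfl, rfl⟩ := Prod.mk.inj h
    grind [mem_gridBox]

theorem HasParityOrder.of_flip {p k l : ℤ} {T : ℤ × ℤ → ZMod 2}
    (h : HasParityOrder integerGrid (gridBox 0 p k l) fun x => T (p - 1 - x.1, x.2)) :
    HasParityOrder integerGrid (gridBox 0 p k l) T := by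
  convert HasParityOrder.map_equiv (T := T) (integerGridFlip (p - 1)) h using 1
  ext ⟨i, j⟩
  simp only [Finset.mem_map, Prod.exists]
  constructor
  · refine fun hx => ⟨p - 1 - i, j, by grind [mem_gridBox], Prod.ext ?_ rfl⟩
    exact sub_sub_cancel (p - 1) i
  · rintro ⟨x, y, hxy, h⟩
    obtain ⟨rfl, rfl⟩ := Prod.mk.inj h
    simp only [mem_gridBox, Equiv.subLeft_apply, Equiv.refl_apply] at hxy ⊢
    omega

theorem hasParityOrderIf_gridBox_odd_cols (a k : ℤ) (m n : ℕ) :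
    HasParityOrderIf integerGrid (gridBox a (a + (n + 1)) k (k + (2 * m + 1))) ∅ 0 :=
  fun _ _ => HasParityOrder.of_swap (hasParityOrderIf_gridBox_odd_rows k a m n _ rfl)

/-- The column `0` can be filled from the bottom up; the topmost vertex is then only required to
have label `0`. -/
theorem HasParityOrderIf.union_col (h : HasParityOrderIf integerGrid S ∅ 0) {p : ℤ} (m : ℕ)
    (hneg : ∀ i, (i, -1) ∉ S) (hcol : ∀ i, p - m - 2 ≤ i → (i, 0) ∉ S)
    (hS : ∀ i, p - m - 1 ≤ i → i < p → (i, 1) ∈ S) :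
    HasParityOrderIf integerGrid (S ∪ gridBox (p - m - 1) p 0 1) {(p - m - 1, 0)} 0 := by
  induction m with
  | zero =>
    have h₁ := h.insert_odd (v := (p - 1, 0)) (by grind)
      (odd_card_integerGrid false false true false) (by simp)
    convert h₁.of_empty using 1
    · ext ⟨i, j⟩
      grind [mem_gridBox]
  | succ m ih =>
    have h₀ := ih (by grind) (by grind)
    have h₁ := h₀.insert_even (v := (p - (m + 1 : ℕ) - 1, 0)) (by grind [mem_gridBox])
      (even_card_integerGrid false true true false)
      (odd_card_integerGrid false true false false)
    convert h₁ using 1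
    · ext ⟨i, j⟩
      grind [mem_gridBox]

theorem HasParityOrderIf.union_col_pairs {p q : ℤ} (hq : 2 ≤ q) (s : ℕ) (hs : 2 * s < p)
    (h : HasParityOrderIf integerGrid (gridBox 0 p 1 q ∪ gridBox (2 * s) p 0 1) L c)
    (hL : ∀ i j, (i, j) ∈ L → 2 * s + 1 ≤ i ∧ j = 0) :
    HasParityOrderIf integerGrid (gridBox 0 p 0 q) L c := by
  induction s with
  | zero =>
    convert h using 1
    ext ⟨i, j⟩
    grind [mem_gridBox]
  | succ s ih =>
    have hLe : ∀ i : ℤ, i ≤ 2 * s + 1 → Even (L.filter (integerGrid.Adj (i, 0))).card := by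
      refine fun i hi => even_card_integerGrid_of_forall ?_
      rintro ⟨a, b⟩ hab hadj
      have := hL a b hab
      simp only [integerGrid_adj] at hadj
      omega
    refine ih (by grind) ?_ (by grind)
    have h₁ := h.insert_odd (v := ((2 * s : ℤ), 0)) (by grind [mem_gridBox])
      (odd_card_integerGrid false false true false) (hLe _ (by omega))
    have h₂ := h₁.insert_odd (v := ((2 * s + 1 : ℤ), 0)) (by grind [mem_gridBox])
      (odd_card_integerGrid true true true false) (hLe _ le_rfl)
    convert h₂ using 1
    ext ⟨i, j⟩
    grind [mem_gridBox]

theorem hasParityOrder_of_corner (m n : ℕ) {T : ℤ × ℤ → ZMod 2} (hT : T (0, 0) = 0) :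
    HasParityOrder integerGrid (gridBox 0 (2 * m + 2) 0 (2 * n + 2)) T := by
  have h := (hasParityOrderIf_gridBox_odd_cols 0 1 n (2 * m + 1)).union_col (p := 2 * m + 2)
    (2 * m + 1) (by grind [mem_gridBox]) (by grind [mem_gridBox]) (by grind [mem_gridBox])
  convert h T (by rw [Finset.sum_singleton, ← hT]; congr 2; push_cast; ring) using 1
  ext ⟨i, j⟩
  grind [mem_gridBox]

theorem hasParityOrder_of_boundary_pair (m n s : ℕ) (hs : s < m) {T : ℤ × ℤ → ZMod 2}
    (hT : T (2 * s + 1, 0) + T (2 * s + 2, 0) = 1) :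
    HasParityOrder integerGrid (gridBox 0 (2 * m + 2) 0 (2 * n + 2)) T := by
  have h := (hasParityOrderIf_gridBox_odd_cols 0 1 n (2 * m + 1)).union_col (p := 2 * m + 2)
    (2 * (m - s) - 1) (by grind [mem_gridBox]) (by grind [mem_gridBox]) (by grind [mem_gridBox])
  have hrow : (2 * m + 2 : ℤ) - (2 * (m - s) - 1 : ℕ) - 1 = 2 * s + 2 := by omega
  rw [hrow] at h
  have h₁ := h.insert_odd (v := ((2 * s : ℤ), 0)) (by grind [mem_gridBox])
    (odd_card_integerGrid false false true false)
    (even_card_integerGrid false false false false)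
  have h₂ := h₁.insert_odd_odd (v := ((2 * s + 1 : ℤ), 0)) (by grind [mem_gridBox]) (by grind)
    (odd_card_integerGrid true true true false)
    (odd_card_integerGrid false true false false)
  refine HasParityOrderIf.union_col_pairs (by omega) s (by omega) ?_ ?_ T ?_
    (L := {((2 * s + 1 : ℤ), 0), ((2 * s + 2 : ℤ), 0)}) (c := 0 + 1)
  · convert h₂ using 1
    ext ⟨i, j⟩
    grind [mem_gridBox]
  · grind
  · rw [Finset.sum_pair (by grind), hT, zero_add]

theorem HasParityOrderIf.union_leaves (h : HasParityOrderIf integerGrid S ∅ 0) {r k : ℤ} (t : ℕ)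
    (hk : (r, k) ∈ S) (hS : ∀ i j, r - 1 ≤ i → i ≤ r + 1 → j < k → (i, j) ∉ S) :
    HasParityOrderIf integerGrid (S ∪ gridBox r (r + 1) (k - t) k) ∅ 0 := by
  induction t with
  | zero => simpa [gridBox] using h
  | succ t ih =>
    have h₁ := ih.insert_odd (v := (r, k - t - 1)) (by grind [mem_gridBox])
      (odd_card_integerGrid false false true false) (by simp)
    convert h₁ using 1
    ext ⟨i, j⟩
    grind [mem_gridBox]

theorem HasParityOrderIf.union_row_pairs {p q : ℤ} (s : ℕ) (hs : 2 * s < p)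
    (hq : 0 ≤ q) (h : HasParityOrderIf integerGrid (gridBox (2 * s) p 0 q) L c)
    (hL : ∀ i j, (i, j) ∈ L → 2 * s + 1 ≤ i) :
    HasParityOrderIf integerGrid (gridBox 0 p 0 q) L c := by
  induction s with
  | zero => simpa using h
  | succ s ih =>
    refine ih (by grind) ?_ (by grind)
    lift q to ℕ using hq
    have h₁ := h.union_two_rows (r := 2 * s) (k := 0) (n := q) (by grind [mem_gridBox])
      (by grind) (by grind [mem_gridBox])
    convert h₁ using 1
    ext ⟨i, j⟩
    grind [mem_gridBox]

/-- A row of vertices of degree three, extended to the right from a vertex whose label is only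
required to be `0`, leads to a condition on the sum of the labels in the row. -/
theorem HasParityOrderIf.union_row {r : ℤ} (t : ℕ)
    (h : HasParityOrderIf integerGrid S {(r, 0)} 0)
    (hup : ∀ j : ℤ, 0 < j → j ≤ t → (r - 1, j) ∈ S) (hdown : ∀ j : ℤ, 0 < j → j ≤ t → (r + 1, j) ∈ S)
    (h₀ : (r, 0) ∈ S) (hS : ∀ j : ℤ, 0 < j → j ≤ t + 1 → (r, j) ∉ S) :
    ∃ c, HasParityOrderIf integerGrid (S ∪ gridBox r (r + 1) 0 (t + 1))
      (gridBox r (r + 1) 0 (t + 1)) c := by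
  induction t with
  | zero =>
    refine ⟨0, ?_⟩
    convert h using 1
    · ext ⟨i, j⟩
      grind [mem_gridBox]
    · ext ⟨i, j⟩
      grind [mem_gridBox]
  | succ t ih =>
    obtain ⟨c, hc⟩ := ih (by grind) (by grind) (by grind)
    have h₁ := hc.insert_odd_odd (v := (r, (t + 1 : ℤ))) (by grind [mem_gridBox])
      (by grind [mem_gridBox]) (odd_card_integerGrid true true false true)
      (odd_card_integerGrid false false false true)
    refine ⟨c + 1, ?_⟩
    convert h₁ using 1
    · ext ⟨i, j⟩
      grind [mem_gridBox]
    · ext ⟨i, j⟩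
      grind [mem_gridBox]

theorem hasParityOrder_of_interior (m n s l : ℕ) (hs : s < m) (hl : l < 2 * n)
    {T : ℤ × ℤ → ZMod 2} (hT : T (2 * s + 1, l + 1) = 0) :
    HasParityOrder integerGrid (gridBox 0 (2 * m + 2) 0 (2 * n + 2)) T := by
  obtain ⟨d, rfl⟩ : ∃ d, m = s + d + 1 := ⟨m - s - 1, by omega⟩
  obtain ⟨e, he⟩ : ∃ e, 2 * n = l + e + 1 := ⟨2 * n - l - 1, by omega⟩
  set p : ℤ := 2 * (s + d + 1 : ℕ) + 2 with hp
  set q : ℤ := 2 * n + 2 with hq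
  have h₀ := hasParityOrderIf_gridBox_odd_cols (2 * s + 2) 1 n (2 * d + 1)
  have h₁ := h₀.union_two_rows (r := 2 * s) (k := l + 2) (n := e + 1) (by grind [mem_gridBox])
    (by simp) (by grind [mem_gridBox])
  have h₂ := h₁.union_leaves (r := 2 * s) (k := l + 2) (l + 2) (by grind [mem_gridBox])
    (by grind [mem_gridBox])
  have h₃ := h₂.union_col (p := p) (2 * d + 1) (by grind [mem_gridBox]) (by grind [mem_gridBox])
    (by grind [mem_gridBox])
  have hrow : p - (2 * d + 1 : ℕ) - 1 = 2 * s + 2 := by omega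
  rw [hrow] at h₃
  have h₄ := h₃.insert_even (v := ((2 * s + 1 : ℤ), 0)) (by grind [mem_gridBox])
    (even_card_integerGrid true true false false) (odd_card_integerGrid false true false false)
  obtain ⟨c, h₅⟩ := h₄.union_row l (by grind [mem_gridBox]) (by grind [mem_gridBox])
    (by grind [mem_gridBox]) (by grind [mem_gridBox])
  have h₆ := h₅.insert_even (v := ((2 * s + 1 : ℤ), (l + 1 : ℤ))) (by grind [mem_gridBox])
    (even_card_integerGrid true true true true) (odd_card_integerGrid false false false true)
  refine HasParityOrderIf.union_row_pairs s (by omega) (by omega) ?_ ?_ T ?_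
    (L := {((2 * s + 1 : ℤ), (l + 1 : ℤ))}) (c := 0)
  · convert h₆ using 1
    ext ⟨i, j⟩
    simp only [Finset.mem_insert, Finset.mem_union, mem_gridBox, Prod.mk.injEq]
    omega
  · grind
  · rw [Finset.sum_singleton, hT]

end IntegerGrid

theorem GraphOrientation.sum_indeg {V : Type*} [Fintype V] {G : SimpleGraph V}
    (o : GraphOrientation G) : ∑ v, o.indeg v = G.edgeSet.ncard := by
  classical
  have h : ∀ v, o.indeg v = ∑ u, if o.dir u v then 1 else 0 := fun v => by
    rw [GraphOrientation.indeg, Set.ncard_eq_toFinset_card', ← Finset.card_filter]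
    congr 1
    ext u
    simp
  rw [Finset.sum_congr rfl fun v _ => h v, ← Finset.sum_product' (s := Finset.univ)
    (t := Finset.univ) (f := fun v u => if o.dir u v then 1 else 0), ← Finset.card_filter,
    Set.ncard_eq_toFinset_card']
  refine Finset.card_bij (fun x _ => s(x.1, x.2)) ?_ ?_ ?_
  · rintro ⟨v, u⟩ h
    simpa using (o.dir_adj u v (by simpa using h)).symm
  · rintro ⟨v, u⟩ h ⟨v', u'⟩ h' he
    simp only [Finset.univ_product_univ, Finset.mem_filter, Finset.mem_univ, true_and] at h h'
    obtain ⟨rfl, rfl⟩ | ⟨rfl, rfl⟩ := Sym2.eq_iff.1 he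
    · rfl
    · exact absurd h' ((o.dir_choice _ _ (o.dir_adj _ _ h)).1 h)
  · intro e he
    induction e with
    | _ u v =>
      have ha : G.Adj u v := by simpa using he
      by_cases hd : o.dir u v
      · exact ⟨(v, u), by simpa using hd, Sym2.eq_swap⟩
      · exact ⟨(u, v), by simpa using (o.dir_choice v u ha.symm).2 hd, rfl⟩

/-- The orientation of `G` from lower to higher rank. -/
def GraphOrientation.ofRank {V : Type*} (G : SimpleGraph V) (r : V → ℤ)
    (hr : Function.Injective r) : GraphOrientation G where
  dir u v := G.Adj u v ∧ r u < r v
  dir_adj _ _ h := h.1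
  dir_choice u v h := by
    have := hr.ne h.ne
    simp only [h, h.symm, true_and]
    omega

theorem GraphOrientation.ofRank_acyclic {V : Type*} (G : SimpleGraph V) (r : V → ℤ)
    (hr : Function.Injective r) : (GraphOrientation.ofRank G r hr).Acyclic := by
  intro v hv
  have h : ∀ u w, Relation.TransGen (GraphOrientation.ofRank G r hr).dir u w → r u < r w := by
    intro u w huw
    induction huw with
    | single h => exact h.2
    | tail _ h ih => exact ih.trans h.2
  exact (h v v hv).false

open Classical in
theorem HasParityOrder.hasAcyclicTOddOrientation {V : Type*} [Fintype V] {G : SimpleGraph V}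
    {T : Set V} (hP : CondP G T)
    (h : HasParityOrder G Finset.univ fun v => if v ∈ T then 1 else 0) :
    HasAcyclicTOddOrientation G T := by
  obtain ⟨r, hr, w, hw⟩ := h
  rw [Finset.coe_univ, Set.injOn_univ] at hr
  set o := GraphOrientation.ofRank G r hr with ho
  have hodd : ∀ v, ((o.indeg v : ZMod 2) = if v ∈ T then 1 else 0) → (Odd (o.indeg v) ↔ v ∈ T) := by
    intro v hv
    rw [← ZMod.natCast_eq_one_iff_odd, hv]
    split_ifs with h <;> simp [h]
  have hne : ∀ v, v ≠ w → (o.indeg v : ZMod 2) = if v ∈ T then 1 else 0 := by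
    intro v hv
    have := hw v (Finset.mem_univ v) hv
    dsimp only at this
    rw [← this, GraphOrientation.indeg, Set.ncard_eq_toFinset_card']
    congr 2
    ext u
    simp [ho, GraphOrientation.ofRank, G.adj_comm]
  have hsum : ∑ v, (o.indeg v : ZMod 2) = ∑ v, if v ∈ T then 1 else 0 := by
    rw [← Nat.cast_sum, o.sum_indeg, Finset.sum_boole]
    have hT : T.ncard = (Finset.univ.filter (· ∈ T)).card := by
      rw [Set.ncard_eq_toFinset_card']
      congr 1
      ext
      simp
    have h₂ := (ZMod.natCast_eq_zero_iff_even).2 hP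
    rw [Nat.cast_add] at h₂
    rw [← hT]
    exact CharTwo.add_eq_zero.1 h₂
  refine ⟨o, GraphOrientation.ofRank_acyclic G r hr, fun v => hodd v ?_⟩
  obtain rfl | hv := eq_or_ne v w
  · rw [← Finset.add_sum_erase _ _ (Finset.mem_univ v),
      ← Finset.add_sum_erase _ (fun v => if v ∈ T then (1 : ZMod 2) else 0) (Finset.mem_univ v),
      Finset.sum_congr rfl fun u hu => hne u (Finset.ne_of_mem_erase hu)] at hsum
    exact add_right_cancel hsum
  · exact hne v hv

theorem HasParityOrder.comap {V W : Type*} [Fintype V] {G : SimpleGraph V} {H : SimpleGraph W}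
    [DecidableRel G.Adj] [DecidableRel H.Adj] [Nonempty V] {S : Finset W} {T : W → ZMod 2}
    (f : G ↪g H) (hS : S = Finset.univ.map f.toEmbedding) (h : HasParityOrder H S T) :
    HasParityOrder G Finset.univ (T ∘ f) := by
  subst hS
  obtain ⟨r, hr, w, hw⟩ := h
  obtain ⟨w', hw'⟩ : ∃ w', ∀ v, v ≠ w' → f v ≠ w := by
    by_cases h : ∃ v, f v = w
    · obtain ⟨v, rfl⟩ := h
      exact ⟨v, fun u hu => f.injective.ne hu⟩
    · exact ⟨Classical.arbitrary V, fun v _ hv => h ⟨v, hv⟩⟩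
  refine ⟨r ∘ f, fun x _ y _ hxy => f.injective (hr (by simp) (by simp) hxy), w', ?_⟩
  intro v _ hv
  have := hw (f v) (by simp) (hw' v hv)
  rw [Finset.filter_map, Finset.card_map] at this
  simpa [Function.comp_def, f.map_adj_iff] using this

section Boundary

variable {m n : ℕ} {T : ℤ × ℤ → ZMod 2}

theorem ZMod.eq_one_of_ne_zero_two {a : ZMod 2} (h : a ≠ 0) : a = 1 := by
  revert a
  decide

theorem badPathInstance_of_not_hasParityOrder
    (h : ¬ HasParityOrder integerGrid (gridBox 0 (2 * m + 2) 0 (2 * n + 2)) T) :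
    BadPathInstance (2 * m + 2) fun i => T (i, 0) = 1 := by
  refine ⟨by grind, ?_, ?_, ?_⟩
  · exact ZMod.eq_one_of_ne_zero_two fun h₀ => h (hasParityOrder_of_corner m n h₀)
  · refine ZMod.eq_one_of_ne_zero_two fun h₀ => h (HasParityOrder.of_flip
      (hasParityOrder_of_corner m n ?_))
    rw [← h₀]
    congr 2
    push_cast
    ring
  · intro k hk hkm
    obtain ⟨s, rfl⟩ : ∃ s, k = s + 1 := ⟨k - 1, by omega⟩
    have h₁ : T (2 * s + 1, 0) + T (2 * s + 2, 0) ≠ 1 := fun h₀ =>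
      h (hasParityOrder_of_boundary_pair m n s (by omega) h₀)
    have e₁ : ((2 * (s + 1) - 1 : ℕ) : ℤ) = 2 * s + 1 := by omega
    have e₂ : ((2 * (s + 1) : ℕ) : ℤ) = 2 * s + 2 := by omega
    dsimp only
    rw [e₁, e₂]
    revert h₁
    generalize T (2 * s + 1, 0) = a
    generalize T (2 * s + 2, 0) = b
    revert a b
    decide

theorem eq_one_of_not_hasParityOrder
    (h : ¬ HasParityOrder integerGrid (gridBox 0 (2 * m + 2) 0 (2 * n + 2)) T) {i j : ℕ}
    (hi : 1 ≤ i) (hi' : i ≤ 2 * m) (hj : 1 ≤ j) (hj' : j ≤ 2 * n) : T (i, j) = 1 := by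
  refine ZMod.eq_one_of_ne_zero_two fun h₀ => h ?_
  obtain ⟨l, rfl⟩ : ∃ l, j = l + 1 := ⟨j - 1, by omega⟩
  obtain ⟨s, hs | hs⟩ := Nat.even_or_odd' i
  · refine HasParityOrder.of_flip
      (hasParityOrder_of_interior m n (m - s) l (by omega) (by omega) ?_)
    rw [← h₀]
    congr 2
    omega
  · refine hasParityOrder_of_interior m n s l (by omega) (by omega) ?_
    rw [← h₀, hs]
    push_cast
    rfl

end Boundary

/-- The grid `P_p □ P_q` as an induced subgraph of the infinite grid. -/
def pathGraphBoxEmbedding (p q : ℕ) : (pathGraph p □ pathGraph q) ↪g integerGrid where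
  toFun u := ((u.1 : ℕ), (u.2 : ℕ))
  inj' := by
    rintro ⟨a, b⟩ ⟨c, d⟩ h
    simpa [Fin.ext_iff] using h
  map_rel_iff' := by
    rintro ⟨a, b⟩ ⟨c, d⟩
    change integerGrid.Adj ((a : ℕ), (b : ℕ)) ((c : ℕ), (d : ℕ)) ↔ _
    simp only [integerGrid_adj, boxProd_adj, pathGraph_adj, Fin.ext_iff]
    omega

theorem gridBox_eq_map (p q : ℕ) :
    gridBox 0 p 0 q = Finset.univ.map (pathGraphBoxEmbedding p q).toEmbedding := by
  ext ⟨i, j⟩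
  simp only [mem_gridBox, Finset.mem_map, Finset.mem_univ, true_and]
  constructor
  · rintro ⟨⟨h₁, h₂⟩, h₃, h₄⟩
    lift i to ℕ using h₁
    lift j to ℕ using h₃
    exact ⟨(⟨i, by omega⟩, ⟨j, by omega⟩), rfl⟩
  · rintro ⟨⟨a, b⟩, h⟩
    obtain ⟨rfl, rfl⟩ := Prod.mk.inj h
    have := a.2
    have := b.2
    omega

section Sufficiency

variable {p q : ℕ} {T : Set (Fin p × Fin q)}

open Classical in
/-- The indicator of a set of vertices of `P_p □ P_q`, extended by zero to the infinite grid. -/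
noncomputable def gridLabel (T : Set (Fin p × Fin q)) (x : ℤ × ℤ) : ZMod 2 :=
  if ∃ u ∈ T, pathGraphBoxEmbedding p q u = x then 1 else 0

open Classical in
theorem gridLabel_comp (T : Set (Fin p × Fin q)) :
    gridLabel T ∘ pathGraphBoxEmbedding p q = fun v => if v ∈ T then 1 else 0 := by
  ext v
  simp [gridLabel]

theorem gridLabel_eq_one_iff {i j : ℕ} :
    gridLabel T (i, j) = 1 ↔ ∃ (hi : i < p) (hj : j < q), (⟨i, hi⟩, ⟨j, hj⟩) ∈ T := by
  have : gridLabel T (i, j) = 1 ↔ ∃ u ∈ T, pathGraphBoxEmbedding p q u = ((i : ℤ), (j : ℤ)) := by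
    simp [gridLabel]
  rw [this]
  constructor
  · rintro ⟨⟨⟨a, ha⟩, ⟨b, hb⟩⟩, hu, h⟩
    obtain ⟨h₁, h₂⟩ := Prod.mk.inj h
    obtain rfl : a = i := by exact_mod_cast h₁
    obtain rfl : b = j := by exact_mod_cast h₂
    exact ⟨ha, hb, hu⟩
  · rintro ⟨hi, hj, h⟩
    exact ⟨_, h, rfl⟩

theorem hasParityOrder_gridLabel_of_not_badGridInstance (hp : 1 ≤ p) (hq : 1 ≤ q)
    (hT : ¬ BadGridInstance p q T) :
    HasParityOrder integerGrid (gridBox 0 p 0 q) (gridLabel T) := by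
  by_contra h
  obtain ⟨m, rfl | rfl⟩ := Nat.even_or_odd' p
  swap
  · have := hasParityOrderIf_gridBox_odd_rows 0 0 m (q - 1) (gridLabel T) Finset.sum_empty
    refine h (by convert this using 2 <;> grind)
  obtain ⟨n, rfl | rfl⟩ := Nat.even_or_odd' q
  swap
  · have := hasParityOrderIf_gridBox_odd_cols 0 0 n (2 * m - 1) (gridLabel T) Finset.sum_empty
    refine h (by convert this using 2 <;> grind)
  obtain ⟨m, rfl⟩ : ∃ k, m = k + 1 := ⟨m - 1, by omega⟩
  obtain ⟨n, rfl⟩ : ∃ k, n = k + 1 := ⟨n - 1, by omega⟩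
  have e : ∀ k : ℕ, ((2 * (k + 1) : ℕ) : ℤ) = 2 * k + 2 := fun k => by push_cast; ring
  rw [e, e] at h
  have h₁ := fun h' => h (HasParityOrder.of_flip h')
  have h₂ := fun h' => h (HasParityOrder.of_swap h')
  have h₃ := fun h' => h₁ (HasParityOrder.of_swap h')
  have h₄ := fun h' => h₂ (HasParityOrder.of_flip h')
  have h₅ := fun h' => h₄ (HasParityOrder.of_swap h')
  refine hT ⟨by simp, by simp, ?_, ?_, ?_, ?_, ?_⟩
  · intro i j hi hi' hj hj'
    obtain ⟨_, _, h'⟩ := gridLabel_eq_one_iff.1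
      (eq_one_of_not_hasParityOrder h (i := i) (j := j) hi (by omega) hj (by omega))
    exact h'
  · refine (congrArg _ (funext fun i => propext ?_)).mp (badPathInstance_of_not_hasParityOrder h)
    exact gridLabel_eq_one_iff (j := 0)
  · refine (congrArg _ (funext fun i => propext ?_)).mp (badPathInstance_of_not_hasParityOrder h₅)
    refine Iff.trans ?_ gridLabel_eq_one_iff
    congr! 3
    grind
  · refine (congrArg _ (funext fun i => propext ?_)).mp (badPathInstance_of_not_hasParityOrder h₂)
    exact gridLabel_eq_one_iff (i := 0)
  · refine (congrArg _ (funext fun i => propext ?_)).mp (badPathInstance_of_not_hasParityOrder h₃)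
    refine Iff.trans ?_ gridLabel_eq_one_iff
    congr! 3
    grind

theorem hasAcyclicTOddOrientation_of_not_badGridInstance (hp : 1 ≤ p) (hq : 1 ≤ q)
    (hP : CondP (pathGraph p □ pathGraph q) T) (hT : ¬ BadGridInstance p q T) :
    HasAcyclicTOddOrientation (pathGraph p □ pathGraph q) T := by
  classical
  have : Nonempty (Fin p × Fin q) := ⟨⟨0, hp⟩, ⟨0, hq⟩⟩
  refine HasParityOrder.hasAcyclicTOddOrientation hP ?_
  rw [← gridLabel_comp]
  convert (hasParityOrder_gridLabel_of_not_badGridInstance hp hq hT).comap _ (gridBox_eq_map p q)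

end Sufficiency

section Necessity

theorem sum_range_pairs_shift (g : ℕ → ℕ) (m : ℕ) :
    ∑ a ∈ Finset.range (m + 1), (g (2 * a) + g (2 * a + 1)) =
      g 0 + ∑ a ∈ Finset.range m, (g (2 * a + 1) + g (2 * a + 2)) + g (2 * m + 1) := by
  induction m with
  | zero => simp
  | succ m ih =>
    rw [Finset.sum_range_succ, ih, Finset.sum_range_succ]
    ring_nf

/-- Two double counts of a weight on a `(2m+2) × (2n+2)` grid, over the tiling by unit faces
starting at a corner and over the tiling shifted by one, are incompatible. -/
theorem false_of_face_weights {m n : ℕ} (F : ℕ → ℕ → ℕ)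
    (hface : ∀ a ≤ m, ∀ b ≤ n, 2 ≤ F (2 * a) (2 * b) + F (2 * a + 1) (2 * b) +
      (F (2 * a) (2 * b + 1) + F (2 * a + 1) (2 * b + 1)))
    (hinner : ∀ a < m, ∀ b < n, F (2 * a + 1) (2 * b + 1) + F (2 * a + 2) (2 * b + 1) +
      (F (2 * a + 1) (2 * b + 2) + F (2 * a + 2) (2 * b + 2)) ≤ 2)
    (hrow₀ : ∀ a < m, F (2 * a + 1) 0 + F (2 * a + 2) 0 ≤ 1)
    (hrow₁ : ∀ a < m, F (2 * a + 1) (2 * n + 1) + F (2 * a + 2) (2 * n + 1) ≤ 1)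
    (hcol₀ : ∀ b < n, F 0 (2 * b + 1) + F 0 (2 * b + 2) ≤ 1)
    (hcol₁ : ∀ b < n, F (2 * m + 1) (2 * b + 1) + F (2 * m + 1) (2 * b + 2) ≤ 1)
    (h₀₀ : F 0 0 = 0) (h₁₀ : F (2 * m + 1) 0 = 0) (h₀₁ : F 0 (2 * n + 1) = 0)
    (h₁₁ : F (2 * m + 1) (2 * n + 1) = 0) : False := by
  set R : ℕ → ℕ := fun j => ∑ a ∈ Finset.range (m + 1), (F (2 * a) j + F (2 * a + 1) j) with hR
  have hR' : ∀ j, R j = F 0 j + ∑ a ∈ Finset.range m, (F (2 * a + 1) j + F (2 * a + 2) j) +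
      F (2 * m + 1) j := fun j => sum_range_pairs_shift (fun i => F i j) m
  have hlow : (n + 1) * ((m + 1) * 2) ≤
      ∑ b ∈ Finset.range (n + 1), (R (2 * b) + R (2 * b + 1)) := by
    have := Finset.card_nsmul_le_sum (Finset.range (n + 1))
      (fun b => R (2 * b) + R (2 * b + 1)) ((m + 1) * 2) ?_
    · simpa using this
    intro b hb
    rw [← Finset.sum_add_distrib]
    have := Finset.card_nsmul_le_sum (Finset.range (m + 1)) _ 2 fun a ha =>
      hface a (by simpa [Nat.lt_succ_iff] using ha) b (by simpa [Nat.lt_succ_iff] using hb)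
    simpa using this
  have hmid : ∑ b ∈ Finset.range n, (R (2 * b + 1) + R (2 * b + 2)) ≤ n * (2 * m + 2) := by
    have := Finset.sum_le_card_nsmul (Finset.range n)
      (fun b => R (2 * b + 1) + R (2 * b + 2)) (2 * m + 2) ?_
    · simpa using this
    intro b hb
    rw [Finset.mem_range] at hb
    have := Finset.sum_le_card_nsmul (Finset.range m) _ 2 fun a ha =>
      hinner a (by simpa using ha) b hb
    rw [Finset.sum_add_distrib, Finset.card_range, smul_eq_mul] at this
    rw [hR', hR']
    have := hcol₀ b hb
    have := hcol₁ b hb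
    omega
  have hrow : ∀ j, (∀ a < m, F (2 * a + 1) j + F (2 * a + 2) j ≤ 1) →
      ∑ a ∈ Finset.range m, (F (2 * a + 1) j + F (2 * a + 2) j) ≤ m := fun j hj => by
    simpa using Finset.sum_le_card_nsmul (Finset.range m) _ 1 fun a ha => hj a (by simpa using ha)
  have e₀ := hrow _ hrow₀
  have e₁ := hrow _ hrow₁
  rw [sum_range_pairs_shift R n, hR' 0, hR' (2 * n + 1), h₀₀, h₁₀, h₀₁, h₁₁] at hlow
  nlinarith

variable {p q : ℕ} (o : GraphOrientation (pathGraph p □ pathGraph q))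

open Classical in
/-- Indicator of the arcs of an orientation of `P_p □ P_q`, as a function on the infinite grid. -/
noncomputable def GraphOrientation.arc (x y : ℤ × ℤ) : ℕ :=
  if ∃ u v, o.dir u v ∧ pathGraphBoxEmbedding p q u = x ∧ pathGraphBoxEmbedding p q v = y
  then 1 else 0

/-- In-degree of a vertex of the infinite grid with respect to the arcs of `o`. -/
noncomputable def GraphOrientation.gridIndeg (i j : ℤ) : ℕ :=
  o.arc (i - 1, j) (i, j) + o.arc (i + 1, j) (i, j) + o.arc (i, j - 1) (i, j) +
    o.arc (i, j + 1) (i, j)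

/-- Indicator that the edges at `(i, j)` in the directions `(s, 0)` and `(0, t)` are both
incoming or both outgoing. -/
noncomputable def GraphOrientation.turn (s t i j : ℤ) : ℕ :=
  if o.arc (i + s, j) (i, j) = o.arc (i, j + t) (i, j) then 1 else 0

theorem GraphOrientation.arc_map (u v : Fin p × Fin q) [Decidable (o.dir u v)] :
    o.arc (pathGraphBoxEmbedding p q u) (pathGraphBoxEmbedding p q v) =
      if o.dir u v then 1 else 0 := by
  rw [GraphOrientation.arc]
  congr 1
  simp

theorem GraphOrientation.dir_of_arc_eq_one {x y : ℤ × ℤ} (h : o.arc x y = 1) :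
    ∃ u v, o.dir u v ∧ pathGraphBoxEmbedding p q u = x ∧ pathGraphBoxEmbedding p q v = y := by
  rw [GraphOrientation.arc] at h
  split_ifs at h with h'
  exact h'

theorem GraphOrientation.arc_le_one (x y : ℤ × ℤ) : o.arc x y ≤ 1 := by
  rw [GraphOrientation.arc]
  split_ifs <;> simp

theorem GraphOrientation.arc_add_arc {x y : ℤ × ℤ} (hx : x ∈ gridBox 0 p 0 q)
    (hy : y ∈ gridBox 0 p 0 q) (h : integerGrid.Adj x y) : o.arc x y + o.arc y x = 1 := by
  classical
  rw [gridBox_eq_map] at hx hy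
  obtain ⟨u, -, rfl⟩ := Finset.mem_map.1 hx
  obtain ⟨v, -, rfl⟩ := Finset.mem_map.1 hy
  have h' := o.dir_choice u v ((pathGraphBoxEmbedding p q).map_adj_iff.1 h)
  simp only [RelEmbedding.coe_toEmbedding, GraphOrientation.arc_map]
  by_cases o.dir v u <;> simp_all

theorem GraphOrientation.arc_eq_zero {x y : ℤ × ℤ} (hx : x ∉ gridBox 0 p 0 q) :
    o.arc x y = 0 := by
  by_contra h
  obtain ⟨u, v, -, rfl, -⟩ := o.dir_of_arc_eq_one (x := x) (y := y)
    (by have := o.arc_le_one x y; omega)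
  exact hx (by rw [gridBox_eq_map]; exact Finset.mem_map_of_mem _ (Finset.mem_univ u))

variable {o}

theorem GraphOrientation.Acyclic.arc_four_cycle (h : o.Acyclic) (x y z w : ℤ × ℤ) :
    o.arc x y + o.arc y z + o.arc z w + o.arc w x ≤ 3 := by
  by_contra hlt
  have := o.arc_le_one x y
  have := o.arc_le_one y z
  have := o.arc_le_one z w
  have := o.arc_le_one w x
  obtain ⟨a, b, hab, rfl, rfl⟩ := o.dir_of_arc_eq_one (x := x) (y := y) (by omega)
  obtain ⟨b', c, hbc, hb, rfl⟩ := o.dir_of_arc_eq_one (y := z)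
    (x := pathGraphBoxEmbedding p q b) (by omega)
  obtain ⟨c', d, hcd, hc, rfl⟩ := o.dir_of_arc_eq_one (y := w)
    (x := pathGraphBoxEmbedding p q c) (by omega)
  obtain ⟨d', a', hda, hd, ha⟩ := o.dir_of_arc_eq_one (x := pathGraphBoxEmbedding p q d)
    (y := pathGraphBoxEmbedding p q a) (by omega)
  obtain rfl := (pathGraphBoxEmbedding p q).injective hb
  obtain rfl := (pathGraphBoxEmbedding p q).injective hc
  obtain rfl := (pathGraphBoxEmbedding p q).injective hd
  obtain rfl := (pathGraphBoxEmbedding p q).injective ha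
  exact h a' ((((Relation.TransGen.single hab).tail hbc).tail hcd).tail hda)

theorem GraphOrientation.gridIndeg_eq_indeg (o : GraphOrientation (pathGraph p □ pathGraph q))
    (i : Fin p) (j : Fin q) : o.gridIndeg (i : ℕ) (j : ℕ) = o.indeg (i, j) := by
  classical
  set f := pathGraphBoxEmbedding p q
  have hf : ((((i : ℕ) : ℤ), ((j : ℕ) : ℤ)) : ℤ × ℤ) = f (i, j) := rfl
  have h₁ : o.indeg (i, j) = ∑ x ∈ Finset.univ.map f.toEmbedding, o.arc x (f (i, j)) := by
    simp only [Finset.sum_map, RelEmbedding.coe_toEmbedding, f, GraphOrientation.arc_map]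
    rw [GraphOrientation.indeg, Set.ncard_eq_toFinset_card', ← Finset.card_filter]
    congr 1
    ext u
    simp
  have h₂ : o.gridIndeg (i : ℕ) (j : ℕ) = ∑ x ∈ ({(((i : ℕ) : ℤ) - 1, ((j : ℕ) : ℤ)),
      (((i : ℕ) : ℤ) + 1, ((j : ℕ) : ℤ)), (((i : ℕ) : ℤ), ((j : ℕ) : ℤ) - 1),
      (((i : ℕ) : ℤ), ((j : ℕ) : ℤ) + 1)} : Finset (ℤ × ℤ)), o.arc x (f (i, j)) := by
    rw [Finset.sum_insert (by simp; omega), Finset.sum_insert (by simp),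
      Finset.sum_insert (by simp; omega), Finset.sum_singleton, GraphOrientation.gridIndeg, hf]
    ring
  rw [h₁, h₂]
  refine Finset.sum_congr_of_eq_on_inter ?_ ?_ fun _ _ _ => rfl
  · intro x _ hx
    refine o.arc_eq_zero fun hx' => hx ?_
    rwa [gridBox_eq_map] at hx'
  · intro x _ hx
    by_contra h
    obtain ⟨u, v, huv, rfl, hv⟩ := o.dir_of_arc_eq_one (x := x) (y := f (i, j))
      (by have := o.arc_le_one x (f (i, j)); omega)
    have hadj := f.map_adj_iff.2 (o.dir_adj _ _ huv)
    rw [hv, ← hf, integerGrid_adj] at hadj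
    refine hx ?_
    simp only [Finset.mem_insert, Finset.mem_singleton, Prod.ext_iff, f] at hadj ⊢
    omega

variable {i j s t : ℤ}

theorem GraphOrientation.Acyclic.two_le_turn (h : o.Acyclic) (hi : 0 ≤ i) (hi' : i + 1 < p)
    (hj : 0 ≤ j) (hj' : j + 1 < q) :
    2 ≤ o.turn 1 1 i j + o.turn (-1) 1 (i + 1) j +
      (o.turn 1 (-1) i (j + 1) + o.turn (-1) (-1) (i + 1) (j + 1)) := by
  have c₁ := h.arc_four_cycle (i, j) (i + 1, j) (i + 1, j + 1) (i, j + 1)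
  have c₂ := h.arc_four_cycle (i, j) (i, j + 1) (i + 1, j + 1) (i + 1, j)
  have a₁ := o.arc_add_arc (x := (i, j)) (y := (i + 1, j)) (by grind [mem_gridBox])
    (by grind [mem_gridBox]) (by grind [integerGrid_adj])
  have a₂ := o.arc_add_arc (x := (i + 1, j)) (y := (i + 1, j + 1)) (by grind [mem_gridBox])
    (by grind [mem_gridBox]) (by grind [integerGrid_adj])
  have a₃ := o.arc_add_arc (x := (i + 1, j + 1)) (y := (i, j + 1)) (by grind [mem_gridBox])
    (by grind [mem_gridBox]) (by grind [integerGrid_adj])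
  have a₄ := o.arc_add_arc (x := (i, j + 1)) (y := (i, j)) (by grind [mem_gridBox])
    (by grind [mem_gridBox]) (by grind [integerGrid_adj])
  simp only [GraphOrientation.turn, add_neg_cancel_right]
  split_ifs <;> omega

theorem GraphOrientation.turn_add_turn_neg (ho : Odd (o.gridIndeg i j)) (hs : s = 1 ∨ s = -1)
    (ht : t = 1 ∨ t = -1) : o.turn s t i j + o.turn (-s) (-t) i j = 1 := by
  have := o.arc_le_one (i + 1, j) (i, j)
  have := o.arc_le_one (i - 1, j) (i, j)
  have := o.arc_le_one (i, j + 1) (i, j)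
  have := o.arc_le_one (i, j - 1) (i, j)
  rw [GraphOrientation.gridIndeg, Nat.odd_iff] at ho
  obtain rfl | rfl := hs <;> obtain rfl | rfl := ht <;>
    simp only [GraphOrientation.turn, neg_neg, ← sub_eq_add_neg] <;> split_ifs <;> omega

theorem GraphOrientation.turn_eq_zero (ho : Odd (o.gridIndeg i j)) (hs : s = 1 ∨ s = -1)
    (ht : t = 1 ∨ t = -1) (hi : i - s < 0 ∨ p ≤ i - s) (hj : j - t < 0 ∨ q ≤ j - t) :
    o.turn s t i j = 0 := by
  have h₁ := o.arc_eq_zero (x := (i - s, j)) (y := (i, j)) (by grind [mem_gridBox])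
  have h₂ := o.arc_eq_zero (x := (i, j - t)) (y := (i, j)) (by grind [mem_gridBox])
  have h := turn_add_turn_neg ho hs ht
  have : o.turn (-s) (-t) i j = 1 := by
    rw [GraphOrientation.turn, ← sub_eq_add_neg, ← sub_eq_add_neg, h₁, h₂, if_pos rfl]
  omega

theorem GraphOrientation.turn_add_turn_row_le (hi : 0 ≤ i) (hi' : i + 1 < p) (hj : 0 ≤ j)
    (hj' : j < q) (ho : Odd (o.gridIndeg i j) ↔ Odd (o.gridIndeg (i + 1) j))
    (ht : t = 1 ∨ t = -1) (hjt : j - t < 0 ∨ q ≤ j - t) :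
    o.turn (-1) t i j + o.turn 1 t (i + 1) j ≤ 1 := by
  have h₁ := o.arc_eq_zero (x := (i, j - t)) (y := (i, j)) (by grind [mem_gridBox])
  have h₂ := o.arc_eq_zero (x := (i + 1, j - t)) (y := (i + 1, j)) (by grind [mem_gridBox])
  have a := o.arc_add_arc (x := (i, j)) (y := (i + 1, j)) (by grind [mem_gridBox])
    (by grind [mem_gridBox]) (by grind [integerGrid_adj])
  have := o.arc_le_one (i - 1, j) (i, j)
  have := o.arc_le_one (i + 1 + 1, j) (i + 1, j)
  have := o.arc_le_one (i, j + t) (i, j)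
  have := o.arc_le_one (i + 1, j + t) (i + 1, j)
  simp only [GraphOrientation.gridIndeg, Nat.odd_iff, add_sub_cancel_right] at ho
  obtain rfl | rfl := ht <;>
    simp only [GraphOrientation.turn, ← sub_eq_add_neg, sub_neg_eq_add] at * <;>
    split_ifs <;> omega

theorem GraphOrientation.turn_add_turn_col_le (hi : 0 ≤ i) (hi' : i < p) (hj : 0 ≤ j)
    (hj' : j + 1 < q) (ho : Odd (o.gridIndeg i j) ↔ Odd (o.gridIndeg i (j + 1)))
    (hs : s = 1 ∨ s = -1) (his : i - s < 0 ∨ p ≤ i - s) :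
    o.turn s (-1) i j + o.turn s 1 i (j + 1) ≤ 1 := by
  have h₁ := o.arc_eq_zero (x := (i - s, j)) (y := (i, j)) (by grind [mem_gridBox])
  have h₂ := o.arc_eq_zero (x := (i - s, j + 1)) (y := (i, j + 1)) (by grind [mem_gridBox])
  have a := o.arc_add_arc (x := (i, j)) (y := (i, j + 1)) (by grind [mem_gridBox])
    (by grind [mem_gridBox]) (by grind [integerGrid_adj])
  have := o.arc_le_one (i, j - 1) (i, j)
  have := o.arc_le_one (i, j + 1 + 1) (i, j + 1)
  have := o.arc_le_one (i + s, j) (i, j)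
  have := o.arc_le_one (i + s, j + 1) (i, j + 1)
  simp only [GraphOrientation.gridIndeg, Nat.odd_iff, add_sub_cancel_right] at ho
  obtain rfl | rfl := hs <;>
    simp only [GraphOrientation.turn, ← sub_eq_add_neg, sub_neg_eq_add] at * <;>
    split_ifs <;> omega

theorem GraphOrientation.IsTOdd.odd_gridIndeg_iff {T : Set (Fin p × Fin q)} (h : o.IsTOdd T)
    {i j : ℕ} (hi : i < p) (hj : j < q) :
    Odd (o.gridIndeg i j) ↔ ∃ (hi : i < p) (hj : j < q), (⟨i, hi⟩, ⟨j, hj⟩) ∈ T := by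
  have := h (⟨i, hi⟩, ⟨j, hj⟩)
  rw [← GraphOrientation.gridIndeg_eq_indeg] at this
  simpa [hi, hj] using this

theorem GraphOrientation.IsTOdd.turn_row_le {T : Set (Fin p × Fin q)} (h : o.IsTOdd T)
    {j m : ℕ} (hp : p = 2 * m + 2) (hj : j < q) (ht : t = 1 ∨ t = -1)
    (hjt : (j : ℤ) - t < 0 ∨ q ≤ (j : ℤ) - t)
    (hT : BadPathInstance p fun i => ∃ (hi : i < p) (hj : j < q), (⟨i, hi⟩, ⟨j, hj⟩) ∈ T)
    {a : ℕ} (ha : a < m) :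
    o.turn (-1) t (2 * a + 1 : ℕ) j + o.turn 1 t (2 * a + 2 : ℕ) j ≤ 1 := by
  have hodd := (h.odd_gridIndeg_iff (i := 2 * a + 1) (by omega) hj).trans
    ((hT.2.2.2 (a + 1) (by omega) (by omega)).trans
      (h.odd_gridIndeg_iff (i := 2 * a + 2) (by omega) hj).symm)
  rw [show ((2 * a + 2 : ℕ) : ℤ) = (2 * a + 1 : ℕ) + 1 by push_cast; ring] at hodd ⊢
  exact turn_add_turn_row_le (by omega) (by omega) (by omega) (by omega) hodd ht hjt

theorem GraphOrientation.IsTOdd.turn_col_le {T : Set (Fin p × Fin q)} (h : o.IsTOdd T)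
    {i n : ℕ} (hq : q = 2 * n + 2) (hi : i < p) (hs : s = 1 ∨ s = -1)
    (his : (i : ℤ) - s < 0 ∨ p ≤ (i : ℤ) - s)
    (hT : BadPathInstance q fun j => ∃ (hi : i < p) (hj : j < q), (⟨i, hi⟩, ⟨j, hj⟩) ∈ T)
    {b : ℕ} (hb : b < n) :
    o.turn s (-1) i (2 * b + 1 : ℕ) + o.turn s 1 i (2 * b + 2 : ℕ) ≤ 1 := by
  have hodd := (h.odd_gridIndeg_iff (j := 2 * b + 1) hi (by omega)).trans
    ((hT.2.2.2 (b + 1) (by omega) (by omega)).trans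
      (h.odd_gridIndeg_iff (j := 2 * b + 2) hi (by omega)).symm)
  rw [show ((2 * b + 2 : ℕ) : ℤ) = (2 * b + 1 : ℕ) + 1 by push_cast; ring] at hodd ⊢
  exact turn_add_turn_col_le (by omega) (by omega) (by omega) (by omega) hodd hs his

theorem not_badGridInstance_of_hasAcyclicTOddOrientation {T : Set (Fin p × Fin q)} (hp : 1 ≤ p)
    (hq : 1 ≤ q) (h : HasAcyclicTOddOrientation (pathGraph p □ pathGraph q) T) :
    ¬ BadGridInstance p q T := by
  rintro ⟨hpe, hqe, hinner, hr₀, hr₁, hl₀, hl₁⟩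
  obtain ⟨o, ha, ho⟩ := h
  obtain ⟨m, rfl⟩ : ∃ m, p = 2 * m + 2 := by
    obtain ⟨k, rfl⟩ := hpe
    exact ⟨k - 1, by omega⟩
  obtain ⟨n, rfl⟩ : ∃ n, q = 2 * n + 2 := by
    obtain ⟨k, rfl⟩ := hqe
    exact ⟨k - 1, by omega⟩
  have hpos : ∀ a : ℕ, (-1 : ℤ) ^ (2 * a) = 1 := fun a => by simp
  have hneg : ∀ a : ℕ, (-1 : ℤ) ^ (2 * a + 1) = -1 := fun a => by simp [pow_succ]
  have hpos' : ∀ a : ℕ, (-1 : ℤ) ^ (2 * a + 2) = 1 := fun a => hpos (a + 1)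
  have hodd : ∀ i j : ℕ, 1 ≤ i → i ≤ 2 * m → 1 ≤ j → j ≤ 2 * n → Odd (o.gridIndeg i j) :=
    fun i j hi hi' hj hj' => (ho.odd_gridIndeg_iff (by omega) (by omega)).2
      ⟨_, _, hinner ⟨i, by omega⟩ ⟨j, by omega⟩ hi hi' hj hj'⟩
  refine false_of_face_weights (m := m) (n := n) (fun i j => o.turn ((-1) ^ i) ((-1) ^ j) i j)
    ?_ ?_ ?_ ?_ ?_ ?_ ?_ ?_ ?_ ?_
  all_goals simp only [hpos, hpos', hneg, pow_zero]
  · intro a ha' b hb'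
    have := ha.two_le_turn (i := 2 * a) (j := 2 * b) (by omega) (by push_cast; omega) (by omega)
      (by push_cast; omega)
    push_cast
    exact this
  · intro a ha' b hb'
    have h₁ := ha.two_le_turn (i := 2 * a + 1) (j := 2 * b + 1) (by omega) (by push_cast; omega)
      (by omega) (by push_cast; omega)
    have e₁ := GraphOrientation.turn_add_turn_neg (s := 1) (t := 1)
      (hodd (2 * a + 1) (2 * b + 1) (by omega) (by omega) (by omega) (by omega)) (by simp) (by simp)
    have e₂ := GraphOrientation.turn_add_turn_neg (s := -1) (t := 1)
      (hodd (2 * a + 2) (2 * b + 1) (by omega) (by omega) (by omega) (by omega)) (by simp) (by simp)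
    have e₃ := GraphOrientation.turn_add_turn_neg (s := 1) (t := -1)
      (hodd (2 * a + 1) (2 * b + 2) (by omega) (by omega) (by omega) (by omega)) (by simp) (by simp)
    have e₄ := GraphOrientation.turn_add_turn_neg (s := -1) (t := -1)
      (hodd (2 * a + 2) (2 * b + 2) (by omega) (by omega) (by omega) (by omega)) (by simp) (by simp)
    push_cast at h₁ e₁ e₂ e₃ e₄ ⊢
    rw [add_assoc _ (1 : ℤ) 1, add_assoc _ (1 : ℤ) 1, one_add_one_eq_two] at h₁
    omega
  · exact fun a => ho.turn_row_le rfl (by omega) (by simp) (by simp) hr₀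
  · exact fun a => ho.turn_row_le rfl (by omega) (by simp) (by push_cast; omega) hr₁
  · exact fun b => ho.turn_col_le rfl (by omega) (by simp) (by simp) hl₀
  · exact fun b => ho.turn_col_le rfl (by omega) (by simp) (by push_cast; omega) hl₁
  · exact GraphOrientation.turn_eq_zero ((ho.odd_gridIndeg_iff (by omega) (by omega)).2 hr₀.2.1)
      (by simp) (by simp) (by simp) (by simp)
  · exact GraphOrientation.turn_eq_zero ((ho.odd_gridIndeg_iff (by omega) (by omega)).2 hr₀.2.2.1)
      (by simp) (by simp) (by push_cast; omega) (by simp)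
  · exact GraphOrientation.turn_eq_zero ((ho.odd_gridIndeg_iff (by omega) (by omega)).2 hr₁.2.1)
      (by simp) (by simp) (by simp) (by push_cast; omega)
  · exact GraphOrientation.turn_eq_zero ((ho.odd_gridIndeg_iff (by omega) (by omega)).2 hr₁.2.2.1)
      (by simp) (by simp) (by push_cast; omega) (by push_cast; omega)

end Necessity

/-- Theorem 3: a grid `P_p □ P_q` with `T` satisfying `𝒫` admits an acyclic
`T`-odd orientation iff `(G, T)` is not a bad grid instance. -/
theorem grid_carac (p q : ℕ) (hp : 1 ≤ p) (hq : 1 ≤ q) (T : Set (Fin p × Fin q))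
    (hP : CondP (pathGraph p □ pathGraph q) T) :
    HasAcyclicTOddOrientation (pathGraph p □ pathGraph q) T ↔ ¬ BadGridInstance p q T := by
  exact ⟨not_badGridInstance_of_hasAcyclicTOddOrientation hp hq,
    hasAcyclicTOddOrientation_of_not_badGridInstance hp hq hP⟩
end

section
/- Lemma (connectedness): If a finite simple graph G belongs to the class C_{P,S,S̄} and has at least 4 vertices, then G is connected. -/
open SimpleGraph

/-- The edges with both ends in `A`. -/
def edgesWithin {V : Type*} (G : SimpleGraph V) (A : Set V) : Set (Sym2 V) :=
  {e ∈ G.edgeSet | ∀ x ∈ e, x ∈ A}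

theorem mk_mem_edgesWithin {V : Type*} {G : SimpleGraph V} {A : Set V} {x y : V} :
    s(x, y) ∈ edgesWithin G A ↔ G.Adj x y ∧ x ∈ A ∧ y ∈ A := by
  simp [edgesWithin]

open Classical in
/-- If no edge leaves `A`, the in-degrees over `A` add up to the number of edges inside `A`. -/
theorem GraphOrientation.sum_indeg_eq {V : Type*} [Fintype V] {G : SimpleGraph V}
    (o : GraphOrientation G) (A : Set V) (hA : ∀ x y, G.Adj x y → y ∈ A → x ∈ A) :
    ∑ v with v ∈ A, o.indeg v = (edgesWithin G A).ncard := by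
  have hindeg : ∀ v, o.indeg v = (Finset.univ.filter fun u => o.dir u v).card := by
    intro v
    rw [GraphOrientation.indeg, ← Set.ncard_coe_finset]
    simp
  simp only [hindeg]
  rw [← Finset.card_sigma, Set.ncard_eq_toFinset_card']
  refine Finset.card_nbij (fun p => s(p.2, p.1)) ?_ ?_ ?_
  · rintro ⟨v, u⟩ hp
    simp only [Finset.coe_sigma, Set.mem_sigma_iff, Finset.coe_filter, Finset.mem_univ, true_and,
      Set.mem_ofPred_eq] at hp
    have hadj := o.dir_adj _ _ hp.2
    have hu := hA _ _ hadj hp.1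
    exact Set.mem_toFinset.2 (mk_mem_edgesWithin.2 ⟨hadj, hu, hp.1⟩)
  · rintro ⟨v, u⟩ hp ⟨v', u'⟩ hq heq
    simp only [Finset.coe_sigma, Set.mem_sigma_iff, Finset.coe_filter, Finset.mem_univ, true_and,
      Set.mem_ofPred_eq] at hp hq
    simp only [Sym2.eq_iff] at heq
    rcases heq with ⟨rfl, rfl⟩ | ⟨rfl, rfl⟩
    · rfl
    · exact absurd hq.2 ((o.dir_choice _ _ (o.dir_adj _ _ hp.2)).1 hp.2)
  · intro e he
    induction e with
    | _ x y =>
      obtain ⟨hadj, hx, hy⟩ := mk_mem_edgesWithin.1 (Set.mem_toFinset.1 he)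
      by_cases hd : o.dir x y
      · exact ⟨⟨y, x⟩, by simp [hd, hy], rfl⟩
      · have hd' : o.dir y x := (o.dir_choice _ _ hadj.symm).2 hd
        exact ⟨⟨x, y⟩, by simp [hd', hx], Sym2.eq_swap⟩

open Classical in
/-- The parity obstruction to a `T`-odd orientation on a set that no edge leaves. -/
theorem GraphOrientation.IsTOdd.odd_ncard_inter_iff {V : Type*} [Fintype V] {G : SimpleGraph V}
    {o : GraphOrientation G} {T : Set V} (hT : o.IsTOdd T) (A : Set V)
    (hA : ∀ x y, G.Adj x y → y ∈ A → x ∈ A) :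
    Odd (T ∩ A).ncard ↔ Odd (edgesWithin G A).ncard := by
  rw [← o.sum_indeg_eq A hA, Finset.odd_sum_iff_odd_card_odd, ← Set.ncard_coe_finset]
  have : (((Finset.univ.filter (· ∈ A)).filter fun v => Odd (o.indeg v) : Finset V) : Set V)
      = T ∩ A := by
    ext v
    simp [hT v, and_comm]
  rw [this]

/-- A vertex can be removed from, or kept in, a singleton so as to meet a parity constraint. -/
theorem exists_subset_singleton_even_add {V : Type*} (x : V) (n : ℕ) :
    ∃ S ⊆ ({x} : Set V), Even (n + S.ncard) := by
  rcases Nat.even_or_odd n with hn | hn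
  · exact ⟨∅, by simp, by simpa using hn⟩
  · exact ⟨{x}, subset_rfl, by simpa using hn.add_one⟩

theorem ncard_le_one_of_subset_singleton {V : Type*} {S : Set V} {x : V} (h : S ⊆ {x}) :
    S.ncard ≤ 1 := by
  simpa using Set.ncard_le_ncard h

/-- With `A` a set that no edge leaves, `a ∈ A` and `b ∉ A`, some `T` that differs from `R ⊆ A`
at most in the vertices `a` and `b` satisfies `𝒫` but admits no `T`-odd orientation. -/
theorem exists_condP_not_hasAcyclicTOddOrientation {V : Type*} [Fintype V] (G : SimpleGraph V)
    {A R : Set V} (hA : ∀ x y, G.Adj x y → y ∈ A → x ∈ A) (hR : R ⊆ A) {a b : V}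
    (ha : a ∈ A) (haR : a ∉ R) (hb : b ∉ A) :
    ∃ T : Set V, R ⊆ T ∧ T.ncard ≤ R.ncard + 2 ∧ CondP G T ∧
      ¬ HasAcyclicTOddOrientation G T := by
  obtain ⟨S, hS, hSe⟩ := exists_subset_singleton_even_add a
    ((edgesWithin G A).ncard + 1 + R.ncard)
  obtain ⟨S', hS', hSe'⟩ := exists_subset_singleton_even_add b
    (G.edgeSet.ncard + (R ∪ S).ncard)
  have hSA : S ⊆ A := hS.trans (by simpa using ha)
  have hRS : (R ∪ S).ncard = R.ncard + S.ncard :=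
    Set.ncard_union_eq (Set.disjoint_left.2 fun x hx hxS => haR (hS hxS ▸ hx))
  have hS'A : Disjoint S' A := Set.disjoint_left.2 fun x hx hxA => hb (hS' hx ▸ hxA)
  have hdisj : Disjoint (R ∪ S) S' := (hS'A.mono_right (Set.union_subset hR hSA)).symm
  have hcard : (R ∪ S ∪ S').ncard = (R ∪ S).ncard + S'.ncard := Set.ncard_union_eq hdisj
  have hinter : (R ∪ S ∪ S') ∩ A = R ∪ S := by
    rw [Set.union_inter_distrib_right, hS'A.inter_eq, Set.union_empty,
      Set.inter_eq_left.2 (Set.union_subset hR hSA)]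
  refine ⟨R ∪ S ∪ S', fun x hx => Or.inl (Or.inl hx), ?_, ?_, ?_⟩
  · have := ncard_le_one_of_subset_singleton hS
    have := ncard_le_one_of_subset_singleton hS'
    omega
  · rw [CondP, hcard, ← add_assoc]
    exact hSe'
  · rintro ⟨o, -, ho⟩
    have := ho.odd_ncard_inter_iff A hA
    rw [hinter, hRS] at this
    grind

/-- Lemma: any graph of `C_{P,S,S̄}` with at least four vertices is connected. -/
theorem memCPSSbar_connected {V : Type*} [Fintype V] (G : SimpleGraph V)
    (h : MemCPSSbar G) (hV : 4 ≤ Fintype.card V) : G.Connected := by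
  have : Nonempty V := Fintype.card_pos_iff.1 (by omega)
  rw [← Nat.card_eq_fintype_card] at hV
  have hcompl : ∀ T : Set V, T.ncard + Tᶜ.ncard = Nat.card V := Set.ncard_add_ncard_compl
  by_contra hG
  have hsep : ∀ u, ∃ b, ¬ G.Reachable u b := by
    intro u
    by_contra! hu
    exact hG ⟨fun x y => (hu x).symm.trans (hu y)⟩
  have hclosed : ∀ u x y, G.Adj x y → y ∈ {z | G.Reachable u z} → x ∈ {z | G.Reachable u z} :=
    fun u x y hxy hy => hy.trans hxy.symm.reachable
  by_cases hodd : ∃ u, Odd (vdeg G u)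
  · obtain ⟨u, hu⟩ := hodd
    obtain ⟨b, hb⟩ := hsep u
    obtain ⟨a, ha⟩ : (G.neighborSet u).Nonempty := by
      rw [Set.nonempty_iff_ne_empty]
      intro h0
      simp [vdeg, h0] at hu
    rw [mem_neighborSet] at ha
    obtain ⟨T, hRT, hcard, hP, hT⟩ := exists_condP_not_hasAcyclicTOddOrientation G (hclosed u)
      (R := {u}) (a := a) (b := b) (by simp) ha.reachable (by simpa using ha.ne') hb
    have huT : u ∈ T := hRT rfl
    have hsink : u ∈ sinkSet G T := Or.inl ⟨huT, hu⟩
    have hne : sinkSet G T ≠ sourceSet T := fun he => (he ▸ hsink : u ∈ sourceSet T) huT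
    refine hT (h T hP ⟨?_, fun _ => Or.inr hne.symm⟩ ⟨⟨u, hsink⟩, fun _ => Or.inr hne⟩)
    apply Set.nonempty_of_ncard_ne_zero
    rw [Set.ncard_singleton] at hcard
    have := hcompl T
    rw [sourceSet]
    omega
  · obtain ⟨u⟩ := this
    obtain ⟨b, hb⟩ := hsep u
    obtain ⟨T, -, hcard, hP, hT⟩ := exists_condP_not_hasAcyclicTOddOrientation G (hclosed u)
      (R := ∅) (a := u) (b := b) (by simp) (Reachable.refl u) (by simp) hb
    have hsink : sinkSet G T = sourceSet T := by
      ext v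
      have hv : Even (vdeg G v) := Nat.not_odd_iff_even.1 fun hv => hodd ⟨v, hv⟩
      simp [sinkSet, sourceSet, hv]
    have htwo : 2 ≤ (sourceSet T).ncard := by
      rw [Set.ncard_empty] at hcard
      have := hcompl T
      rw [sourceSet]
      omega
    have hsource : CondS G T :=
      ⟨Set.nonempty_of_ncard_ne_zero (by omega), fun h1 => by omega⟩
    refine hT (h T hP hsource ?_)
    rw [CondSbar, hsink]
    exact ⟨hsource.1, fun h1 => by omega⟩
end

section
/- Lemma (trees): Every finite tree belongs to the class C_P; that is, if G is a finite connected acyclic simple graph and T ⊆ V(G) satisfies |E(G)| + |T| even, then G admits an acyclic T-odd orientation. -/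
open SimpleGraph

/-- Orient every edge of `G` towards its endpoint of larger rank: the resulting orientation
is acyclic. -/
theorem exists_acyclic_orientation_of_rank {V : Type*} (G : SimpleGraph V) (f : V → ℤ)
    (hf : ∀ u v, G.Adj u v → f u ≠ f v) :
    ∃ o : GraphOrientation G, o.Acyclic ∧ ∀ u v, o.dir u v ↔ G.Adj u v ∧ f u < f v := by
  refine ⟨⟨fun u v => G.Adj u v ∧ f u < f v, fun u v h => h.1, fun u v h => ?_⟩, ?_,
    fun u v => Iff.rfl⟩
  · have := hf u v h
    simp only [h, h.symm, true_and]
    omega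
  · have key : ∀ a b, Relation.TransGen (fun u v => G.Adj u v ∧ f u < f v) a b → f a < f b := by
      intro a b h
      induction h with
      | single h => exact h.2
      | tail _ h ih => exact ih.trans h.2
    exact fun a h => (key a a h).false

/-- The parity of `T` after deleting a leaf `v` with neighbour `u`, where membership of `u` is
toggled when `v ∉ T`. -/
theorem odd_ncard_delete_leaf {V : Type*} [Finite V] {u v : V} (huv : u ≠ v) (T : Set V) :
    Odd ({x : ({v}ᶜ : Set V) | ((x : V) ∈ T ↔ (v ∈ T ∨ (x : V) ≠ u))}.ncard + T.ncard) := by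
  rw [← Set.ncard_image_of_injective _ Subtype.val_injective]
  set S := Subtype.val '' {x : ({v}ᶜ : Set V) | ((x : V) ∈ T ↔ (v ∈ T ∨ (x : V) ≠ u))} with hS
  have mem : ∀ x, x ∈ S ↔ x ≠ v ∧ (x ∈ T ↔ (v ∈ T ∨ x ≠ u)) := by
    intro x
    simp [hS, and_comm]
  by_cases hv : v ∈ T
  · have hT : T = insert v S := by
      ext x
      simp only [Set.mem_insert_iff, mem]
      grind
    have hvS : v ∉ S := fun h => ((mem v).1 h).1 rfl
    rw [hT, Set.ncard_insert_of_notMem hvS]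
    grind
  · by_cases hu : u ∈ T
    · have hT : T = insert u S := by
        ext x
        simp only [Set.mem_insert_iff, mem]
        grind
      have huS : u ∉ S := by simp [mem, hu, hv]
      rw [hT, Set.ncard_insert_of_notMem huS]
      grind
    · have hT : S = insert u T := by
        ext x
        simp only [Set.mem_insert_iff, mem]
        grind
      rw [hT, Set.ncard_insert_of_notMem hu]
      grind

/-- A finite tree has a ranking whose induced orientation is `T`-odd. -/
theorem SimpleGraph.IsTree.exists_rank_odd (n : ℕ) :
    ∀ {V : Type*} [Finite V] (G : SimpleGraph V), G.IsTree → Nat.card V = n →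
      ∀ T : Set V, Odd (Nat.card V + T.ncard) →
      ∃ f : V → ℤ, (∀ u v, G.Adj u v → f u ≠ f v) ∧
        ∀ v, Odd {u | G.Adj u v ∧ f u < f v}.ncard ↔ v ∈ T := by
  induction n with
  | zero =>
    intro V _ G hG hn
    have := hG.connected.nonempty
    exact absurd hn Nat.card_pos.ne'
  | succ n ih =>
    intro V _ G hG hn T hT
    classical
    have := Fintype.ofFinite V
    rcases subsingleton_or_nontrivial V with hV | hV
    · have hadj : ∀ u v, ¬ G.Adj u v := fun u v h => h.ne (Subsingleton.elim u v)
      refine ⟨fun _ => 0, fun u v h => absurd h (hadj u v), fun v => ?_⟩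
      have hc : Nat.card V = 1 := Nat.card_eq_one_iff_unique.2 ⟨hV, ⟨v⟩⟩
      have hv : v ∉ T := by
        intro hv
        have : T = {v} := Set.Subsingleton.eq_singleton_of_mem Set.subsingleton_of_subsingleton hv
        rw [hc, this, Set.ncard_singleton] at hT
        exact absurd hT (by decide)
      simp [hv]
    · obtain ⟨v, hv⟩ := hG.exists_vert_degree_one_of_nontrivial
      have hconn := hG.connected.induce_compl_singleton_of_degree_eq_one hv
      obtain ⟨u, hvu, hu⟩ := degree_eq_one_iff_existsUnique_adj.mp hv
      have huv : u ≠ v := hvu.ne'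
      have hcard : Nat.card ({v}ᶜ : Set V) + 1 = Nat.card V := by
        rw [Nat.card_coe_set_eq, ← Set.ncard_singleton v, add_comm, Set.ncard_add_ncard_compl]
      have hpar := odd_ncard_delete_leaf huv T
      obtain ⟨f, hf, hodd⟩ := ih (G.induce {v}ᶜ) ⟨hconn, hG.isAcyclic.induce _⟩ (by omega)
        {x : ({v}ᶜ : Set V) | ((x : V) ∈ T ↔ (v ∈ T ∨ (x : V) ≠ u))} (by grind)
      let g : V → ℤ := fun x =>
        if h : x = v then f ⟨u, huv⟩ + (if v ∈ T then 1 else -1) else f ⟨x, h⟩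
      have gv : g v = f ⟨u, huv⟩ + (if v ∈ T then 1 else -1) := by simp [g]
      have gne : ∀ x (h : x ≠ v), g x = f ⟨x, h⟩ := fun x h => by simp [g, h]
      have gu := gne u huv
      have hgv : g v ≠ g u := by
        rw [gv, gu]; split_ifs <;> omega
      have hlt : g u < g v ↔ v ∈ T := by
        rw [gv, gu]; split_ifs with h <;> simp [h]
      have hlt' : g v < g u ↔ v ∉ T := by
        rw [gv, gu]; split_ifs with h <;> simp [h]
      refine ⟨g, fun a b hab => ?_, fun x => ?_⟩
      · by_cases ha : a = v
        · subst ha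
          rwa [hu b hab]
        · by_cases hb : b = v
          · subst hb
            rw [hu a hab.symm]
            exact hgv.symm
          · rw [gne a ha, gne b hb]
            exact hf _ _ hab
      · by_cases hx : x = v
        · subst hx
          by_cases hxT : x ∈ T
          · have : {w | G.Adj w x ∧ g w < g x} = {u} := by
              ext w
              constructor
              · exact fun h => hu w h.1.symm
              · rintro rfl
                exact ⟨hvu.symm, hlt.2 hxT⟩
            simp [this, hxT]
          · have : {w | G.Adj w x ∧ g w < g x} = ∅ := by
              ext w
              simp only [Set.mem_ofPred_eq, Set.mem_empty_iff_false, iff_false]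
              rintro ⟨h, h'⟩
              rw [hu w h.symm, hlt] at h'
              exact hxT h'
            simp [this, hxT]
        · have hx' := hodd ⟨x, hx⟩
          rw [← Set.ncard_image_of_injective _ Subtype.val_injective] at hx'
          set S := Subtype.val '' {w : ({v}ᶜ : Set V) |
            (G.induce {v}ᶜ).Adj w ⟨x, hx⟩ ∧ f w < f ⟨x, hx⟩} with hS
          have mem : ∀ w, w ∈ S ↔ w ≠ v ∧ G.Adj w x ∧ g w < g x := by
            intro w
            constructor
            · rintro ⟨⟨w, hw⟩, h, rfl⟩
              exact ⟨hw, h.1, by rw [gne w hw, gne x hx]; exact h.2⟩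
            · rintro ⟨hw, h, h'⟩
              rw [gne w hw, gne x hx] at h'
              exact ⟨⟨w, hw⟩, ⟨h, h'⟩, rfl⟩
          have hvS : v ∉ S := fun h => ((mem v).1 h).1 rfl
          simp only [Set.mem_ofPred_eq] at hx'
          by_cases hvx : G.Adj v x ∧ g v < g x
          · have hxu := hu x hvx.1
            subst hxu
            have hvT := hlt'.1 hvx.2
            have : {w | G.Adj w x ∧ g w < g x} = insert v S := by
              ext w
              simp only [Set.mem_ofPred_eq, Set.mem_insert_iff, mem]
              grind
            rw [this, Set.ncard_insert_of_notMem hvS]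
            grind
          · have : {w | G.Adj w x ∧ g w < g x} = S := by
              ext w
              simp only [Set.mem_ofPred_eq, mem]
              grind
            rw [this, hx']
            have : v ∈ T ∨ x ≠ u := by
              by_contra! h
              obtain ⟨h, rfl⟩ := h
              exact hvx ⟨hvu, hlt'.2 h⟩
            simp [this]

/-- Lemma: trees belong to `C_P`. -/
theorem tree_memCP {V : Type*} [Fintype V] (G : SimpleGraph V) (hG : G.IsTree)
    (T : Set V) (hT : Even (G.edgeSet.ncard + T.ncard)) :
    HasAcyclicTOddOrientation G T := by
  classical
  have hE : G.edgeSet.ncard + 1 = Nat.card V := by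
    rw [← coe_edgeFinset, Set.ncard_coe_finset, hG.card_edgeFinset, Nat.card_eq_fintype_card]
  obtain ⟨f, hf, hodd⟩ := SimpleGraph.IsTree.exists_rank_odd _ G hG rfl T (by grind)
  obtain ⟨o, ho, hdir⟩ := exists_acyclic_orientation_of_rank G f hf
  refine ⟨o, ho, fun v => ?_⟩
  simp only [GraphOrientation.indeg, hdir]
  exact hodd v
end

section
/- Lemma (cycles): For every n ≥ 3, the cycle graph C_n belongs to C_{P,S} \ C_P; that is: (1) for every T ⊆ V(C_n) satisfying conditions P and S, C_n admits an acyclic T-odd orientation; and (2) there exists T ⊆ V(C_n) satisfying condition P such that C_n admits no acyclic T-odd orientation. -/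
open SimpleGraph

/-- A function on a cycle with vanishing total sum is the difference of a potential. -/
lemma Fin.exists_potential_of_sum_eq_zero {A : Type*} [AddCommGroup A] {m : ℕ}
    (w : Fin (m + 1) → A) (hw : ∑ v, w v = 0) :
    ∃ h : Fin (m + 1) → A, ∀ v, h (v + 1) = h v + w v := by
  refine ⟨fun v => ∑ j ∈ Finset.range v, w (Fin.ofNat (m + 1) j), fun v => ?_⟩
  have hv : w (Fin.ofNat (m + 1) v) = w v := by simp
  dsimp only
  rw [← hv, ← Finset.sum_range_succ]
  rcases eq_or_ne v (Fin.last m) with rfl | hne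
  · rw [Fin.last_add_one, Fin.val_last, Fin.val_zero, Finset.sum_range_zero, Finset.sum_range]
    simpa using hw.symm
  · rw [Fin.val_add_one_of_lt (Fin.lt_last_iff_ne_last.mpr hne)]

lemma Fin.self_ne_add_one_add_one {m : ℕ} (v : Fin (m + 3)) : v ≠ v + 1 + 1 := by
  rw [add_assoc, ne_eq, left_eq_add]
  exact ne_of_beq_false rfl

/-- The orientation of a cycle directing the edge `{v, v + 1}` forward exactly when `f v` holds. -/
def cycleOrientation {m : ℕ} (f : Fin (m + 3) → Prop) :
    GraphOrientation (cycleGraph (m + 3)) where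
  dir u v := (v = u + 1 ∧ f u) ∨ (u = v + 1 ∧ ¬ f v)
  dir_adj u v := by
    rw [cycleGraph_adj]
    rintro (⟨rfl, -⟩ | ⟨rfl, -⟩) <;> simp
  dir_choice u v := by
    rw [cycleGraph_adj, sub_eq_iff_eq_add', sub_eq_iff_eq_add']
    rintro (rfl | rfl)
    · simp [Fin.self_ne_add_one_add_one]
    · simp [Fin.self_ne_add_one_add_one]

lemma cycleOrientation_acyclic {m : ℕ} {f : Fin (m + 3) → Prop} {a b : Fin (m + 3)}
    (ha : f a) (hb : ¬ f b) : (cycleOrientation f).Acyclic := by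
  classical
  let p : ℕ := (Finset.univ.filter f).card
  let q : ℕ := (Finset.univ.filter (fun v => ¬ f v)).card
  have hp : 0 < p := Finset.card_pos.mpr ⟨a, by simpa using ha⟩
  have hq : 0 < q := Finset.card_pos.mpr ⟨b, by simpa using hb⟩
  obtain ⟨h, hh⟩ := Fin.exists_potential_of_sum_eq_zero
    (fun v : Fin (m + 3) => if f v then (q : ℤ) else -p) (by
      rw [Finset.sum_ite, Finset.sum_const, Finset.sum_const, nsmul_eq_mul, nsmul_eq_mul]
      change (p : ℤ) * q + q * -p = 0
      ring)
  have hdir : ∀ u v, (cycleOrientation f).dir u v → h u < h v := by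
    rintro u v (⟨rfl, hf⟩ | ⟨rfl, hf⟩)
    · rw [hh, if_pos hf]; omega
    · rw [hh, if_neg hf]; omega
  have htrans : ∀ u v, Relation.TransGen (cycleOrientation f).dir u v → h u < h v := by
    intro u v huv
    induction huv with
    | single huv => exact hdir _ _ huv
    | tail _ hvw ih => exact ih.trans (hdir _ _ hvw)
  exact fun v hv => (htrans v v hv).false

lemma odd_indeg_cycleOrientation {m : ℕ} (f : Fin (m + 3) → Prop) (v : Fin (m + 3)) :
    Odd ((cycleOrientation f).indeg v) ↔ (f (v - 1) ↔ f v) := by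
  have hne : v - 1 ≠ v + 1 := by
    have := Fin.self_ne_add_one_add_one (v - 1)
    rwa [sub_add_cancel] at this
  have hset : {u | (cycleOrientation f).dir u v} =
      {u | u = v - 1 ∧ f (v - 1)} ∪ {u | u = v + 1 ∧ ¬ f v} := by
    ext u
    simp only [cycleOrientation, Set.mem_ofPred_eq, Set.mem_union]
    rw [← sub_eq_iff_eq_add, eq_comm (a := v - 1)]
    grind
  rw [GraphOrientation.indeg, hset]
  by_cases h₁ : f (v - 1) <;> by_cases h₂ : f v
  · simp [h₁, h₂]
  · have : ({v - 1} ∪ {v + 1} : Set (Fin (m + 3))).ncard = 2 := Set.ncard_pair hne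
    simp only [h₁, h₂, and_true, not_false_eq_true, Set.ofPred_eq_eq_singleton, this]
    decide
  · simp [h₁, h₂]
  · simp [h₁, h₂]

lemma ncard_edgeSet_cycleGraph (m : ℕ) : (cycleGraph (m + 3)).edgeSet.ncard = m + 3 := by
  have h := (cycleGraph (m + 3)).sum_degrees_eq_twice_card_edges
  simp only [cycleGraph_degree_three_le, Finset.sum_const, Finset.card_univ, Fintype.card_fin,
    smul_eq_mul] at h
  rw [← coe_edgeFinset, Set.ncard_coe_finset]
  omega

/-- An acyclic orientation of a nonempty finite graph has a source. -/
lemma GraphOrientation.Acyclic.exists_indeg_eq_zero {V : Type*} [Finite V] [Nonempty V]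
    {G : SimpleGraph V} {o : GraphOrientation G} (ho : o.Acyclic) : ∃ v, o.indeg v = 0 := by
  have : Std.Irrefl (Relation.TransGen o.dir) := ⟨ho⟩
  have hwf := Finite.wellFounded_of_trans_of_irrefl (Relation.TransGen o.dir)
  obtain ⟨v, -, hv⟩ := hwf.has_min Set.univ Set.univ_nonempty
  refine ⟨v, (Set.ncard_eq_zero (Set.toFinite _)).mpr ?_⟩
  exact Set.eq_empty_of_forall_notMem fun u hu => hv u trivial (.single hu)

/-- If an even, positive number of vertices lie outside `T`, a cycle has an acyclic `T`-odd
orientation: reverse the direction of travel exactly at the vertices outside `T`. -/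
lemma hasAcyclicTOddOrientation_cycleGraph {m : ℕ} {T : Set (Fin (m + 3))}
    (heven : Even Tᶜ.ncard) (hne : Tᶜ.Nonempty) :
    HasAcyclicTOddOrientation (cycleGraph (m + 3)) T := by
  classical
  obtain ⟨h, hh⟩ := Fin.exists_potential_of_sum_eq_zero
    (fun v : Fin (m + 3) => if v ∈ Tᶜ then (1 : ZMod 2) else 0) (by
      rw [Finset.sum_boole, ZMod.natCast_eq_zero_iff_even]
      rwa [Set.ncard_eq_toFinset_card', ← Set.filter_mem_univ_eq_toFinset] at heven)
  let f : Fin (m + 3) → Prop := fun v => h (v + 1) = 0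
  have hf : ∀ v, (f (v - 1) ↔ f v) ↔ v ∈ T := by
    intro v
    simp only [f, sub_add_cancel]
    rw [hh]
    by_cases hv : v ∈ T
    · simp [hv]
    · simp only [Set.mem_compl_iff, hv, not_false_eq_true, if_true, iff_false]
      exact (by decide : ∀ x : ZMod 2, ¬ (x = 0 ↔ x + 1 = 0)) (h v)
  refine ⟨cycleOrientation f, ?_, fun v => (odd_indeg_cycleOrientation f v).trans (hf v)⟩
  obtain ⟨v, hv⟩ := hne
  have hchange : ¬ (f (v - 1) ↔ f v) := fun h => hv ((hf v).mp h)
  by_cases h₂ : f v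
  · exact cycleOrientation_acyclic h₂ (b := v - 1) (by tauto)
  · exact cycleOrientation_acyclic (a := v - 1) (by tauto) h₂

/-- Lemma: cycles belong to `C_{P,S} \ C_P`. -/
theorem cycle_memCPS_not_memCP (n : ℕ) (hn : 3 ≤ n) :
    (∀ T : Set (Fin n), CondP (cycleGraph n) T → CondS (cycleGraph n) T →
      HasAcyclicTOddOrientation (cycleGraph n) T) ∧
    (∃ T : Set (Fin n), CondP (cycleGraph n) T ∧
      ¬ HasAcyclicTOddOrientation (cycleGraph n) T) := by
  obtain ⟨m, rfl⟩ := Nat.exists_eq_add_of_le' hn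
  refine ⟨fun T hP hS => ?_, Set.univ, ?_, ?_⟩
  · refine hasAcyclicTOddOrientation_cycleGraph ?_ hS.1
    have hcard := Set.ncard_add_ncard_compl T
    rw [Nat.card_eq_fintype_card, Fintype.card_fin] at hcard
    rw [CondP, ncard_edgeSet_cycleGraph] at hP
    grind
  · simp [CondP, ncard_edgeSet_cycleGraph, Set.ncard_univ]
  · rintro ⟨o, hacyc, hodd⟩
    obtain ⟨v, hv⟩ := hacyc.exists_indeg_eq_zero
    have := (hodd v).mpr trivial
    simp [hv] at this
end

section
/- Theorem (T-decomposition): Let G be a finite simple graph and T ⊆ V(G). Then G admits an acyclic T-odd orientation if and only if G admits a good T-decomposition. -/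
open SimpleGraph

/-- The set `Z_i` of a `T`-decomposition: vertices of `V_i` with an odd number of
neighbors in `V_0 ∪ … ∪ V_{i-1}`. -/
def decompZ {V : Type*} (G : SimpleGraph V) {k : ℕ} (A : Fin (k + 1) → Set V)
    (i : Fin (k + 1)) : Set V :=
  {v | v ∈ A i ∧ Odd (Set.ncard {u | G.Adj u v ∧ ∃ j, j < i ∧ u ∈ A j})}

/-- A good `T`-decomposition: an ordered partition `⟨V_0, …, V_k⟩` of the vertex set
such that each induced subgraph `G[V_i]` admits an acyclic `T_i`-odd orientation, where
`T_i = Z_i △ (T ∩ V_i)`. -/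
def GoodTDecomposition {V : Type*} (G : SimpleGraph V) (T : Set V) {k : ℕ}
    (A : Fin (k + 1) → Set V) : Prop :=
  Pairwise (Function.onFun Disjoint A) ∧ (⋃ i, A i) = Set.univ ∧
    ∀ i : Fin (k + 1),
      HasAcyclicTOddOrientation (G.induce (A i))
        {v : A i | (v : V) ∈ symmDiff (decompZ G A i) (T ∩ A i)}

/-- The restriction of an orientation to an induced subgraph. -/
def GraphOrientation.induce {V : Type*} {G : SimpleGraph V} (o : GraphOrientation G)
    (s : Set V) : GraphOrientation (G.induce s) where
  dir u v := o.dir u v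
  dir_adj u v h := o.dir_adj u v h
  dir_choice u v h := o.dir_choice u v h

theorem GraphOrientation.Acyclic.induce {V : Type*} {G : SimpleGraph V}
    {o : GraphOrientation G} (ho : o.Acyclic) (s : Set V) : (o.induce s).Acyclic :=
  fun v hv => ho (v : V) (Relation.TransGen.lift Subtype.val (fun _ _ h => h) v v hv)

theorem GraphOrientation.indeg_induce_of_subset {V : Type*} {G : SimpleGraph V}
    (o : GraphOrientation G) {s : Set V} (v : s) (h : {u | o.dir u v} ⊆ s) :
    (o.induce s).indeg v = o.indeg v := by
  have : {u | o.dir u v} = Subtype.val '' {u : s | o.dir u v} := by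
    ext u
    simp only [Set.mem_ofPred_eq, Set.mem_image, Subtype.exists, exists_and_left, exists_prop,
      exists_eq_right_right]
    exact ⟨fun hu => ⟨hu, h hu⟩, fun hu => hu.1⟩
  rw [GraphOrientation.indeg, GraphOrientation.indeg, this,
    Set.ncard_image_of_injective _ Subtype.val_injective]
  rfl

section Glue

variable {V ι : Type*} [LinearOrder ι] {G : SimpleGraph V} (f : V → ι)
  (o : ∀ i, GraphOrientation (G.induce (f ⁻¹' {i})))

/-- Glue orientations of the fibers of `f`, orienting the remaining edges so that `f` increases
along them. -/
def GraphOrientation.glue : GraphOrientation G where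
  dir u v := (G.Adj u v ∧ f u < f v) ∨
    ∃ i, ∃ (hu : f u = i) (hv : f v = i), (o i).dir ⟨u, hu⟩ ⟨v, hv⟩
  dir_adj u v := by
    rintro (h | ⟨i, hu, hv, h⟩)
    · exact h.1
    · exact (o i).dir_adj _ _ h
  dir_choice u v h := by
    rcases lt_trichotomy (f u) (f v) with huv | huv | huv
    · simp [h, huv, huv.not_gt]
      exact fun he => (huv.ne he).elim
    · have key := (o (f v)).dir_choice ⟨u, huv⟩ ⟨v, rfl⟩ h
      simp [huv, key]
    · simp [h.symm, huv, huv.not_gt]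
      exact fun he => (huv.ne he).elim

theorem GraphOrientation.transGen_glue {u v : V}
    (h : Relation.TransGen (GraphOrientation.glue f o).dir u v) :
    f u < f v ∨ ∃ i, ∃ (hu : f u = i) (hv : f v = i),
      Relation.TransGen (o i).dir ⟨u, hu⟩ ⟨v, hv⟩ := by
  induction h with
  | single h =>
    rcases h with h | ⟨i, hu, hv, h⟩
    · exact Or.inl h.2
    · exact Or.inr ⟨i, hu, hv, .single h⟩
  | tail _ h ih =>
    rcases h with h | ⟨i, hb, hc, h⟩
    · rcases ih with ih | ⟨i, hu, hb, -⟩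
      · exact Or.inl (ih.trans h.2)
      · exact Or.inl (by rw [hu, ← hb]; exact h.2)
    · rcases ih with ih | ⟨j, hu, hb', ih⟩
      · exact Or.inl (by rw [hc, ← hb]; exact ih)
      · obtain rfl : j = i := hb'.symm.trans hb
        exact Or.inr ⟨j, hu, hc, ih.tail h⟩

theorem GraphOrientation.acyclic_glue (ho : ∀ i, (o i).Acyclic) :
    (GraphOrientation.glue f o).Acyclic := by
  intro v hv
  rcases GraphOrientation.transGen_glue f o hv with h | ⟨i, _, _, h⟩
  · exact lt_irrefl _ h
  · exact ho i _ h

theorem GraphOrientation.indeg_glue [Finite V] (v : V) :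
    (GraphOrientation.glue f o).indeg v =
      {u | G.Adj u v ∧ f u < f v}.ncard + (o (f v)).indeg ⟨v, rfl⟩ := by
  have h : {u | (GraphOrientation.glue f o).dir u v} =
      {u | G.Adj u v ∧ f u < f v} ∪ Subtype.val '' {u | (o (f v)).dir u ⟨v, rfl⟩} := by
    ext u
    refine or_congr_right ⟨?_, ?_⟩
    · rintro ⟨_, hu, rfl, h⟩
      exact ⟨⟨u, hu⟩, h, rfl⟩
    · rintro ⟨⟨u, hu⟩, h, rfl⟩
      exact ⟨_, hu, rfl, h⟩
  rw [GraphOrientation.indeg, GraphOrientation.indeg, h, Set.ncard_union_eq,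
    Set.ncard_image_of_injective _ Subtype.val_injective]
  rw [Set.disjoint_left]
  rintro _ ⟨-, hlt⟩ ⟨⟨u, hu⟩, -, rfl⟩
  exact hlt.ne hu

end Glue

/-- A family of pairwise disjoint sets covering the whole type is the family of fibers of a
function. -/
theorem exists_eq_fiber_of_partition {V ι : Type*} {A : ι → Set V}
    (hd : Pairwise (Function.onFun Disjoint A)) (hA : (⋃ i, A i) = Set.univ) :
    ∃ f : V → ι, A = fun i => f ⁻¹' {i} := by
  have hex : ∀ v, ∃ i, v ∈ A i := fun v => Set.mem_iUnion.mp (hA ▸ Set.mem_univ v)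
  choose f hf using hex
  refine ⟨f, funext fun i => Set.ext fun v => ⟨fun hv => ?_, fun hv => ?_⟩⟩
  · by_contra hne
    exact Set.disjoint_left.mp (hd hne) (hf v) hv
  · obtain rfl : f v = i := hv
    exact hf v

theorem goodTDecomposition_const_univ {V : Type*} {G : SimpleGraph V} {T : Set V}
    (h : HasAcyclicTOddOrientation G T) :
    GoodTDecomposition (k := 0) G T fun _ => Set.univ := by
  obtain ⟨o, ho, hT⟩ := h
  refine ⟨fun i j hij => (hij (Subsingleton.elim (α := Fin 1) i j)).elim, Set.iUnion_const _, fun i =>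
    ⟨o.induce _, ho.induce _, fun v => ?_⟩⟩
  rw [o.indeg_induce_of_subset v (Set.subset_univ _), hT]
  obtain rfl : i = 0 := Subsingleton.elim (α := Fin 1) i 0
  simp [decompZ, Set.mem_symmDiff]

theorem GoodTDecomposition.hasAcyclicTOddOrientation {V : Type*} [Finite V] {G : SimpleGraph V}
    {T : Set V} {k : ℕ} {A : Fin (k + 1) → Set V} (h : GoodTDecomposition G T A) :
    HasAcyclicTOddOrientation G T := by
  obtain ⟨hd, hA, h⟩ := h
  obtain ⟨f, rfl⟩ := exists_eq_fiber_of_partition hd hA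
  choose o ho hodd using h
  refine ⟨.glue f o, GraphOrientation.acyclic_glue f o ho, fun v => ?_⟩
  have hv := hodd (f v) ⟨v, rfl⟩
  simp only [decompZ, Set.mem_ofPred_eq, Set.mem_symmDiff, Set.mem_inter_iff, Set.mem_preimage,
    Set.mem_singleton_iff, true_and, and_true, exists_eq_right'] at hv
  rw [GraphOrientation.indeg_glue, Nat.odd_add, ← Nat.not_odd_iff_even, hv]
  tauto

/-- Theorem: `G` has an acyclic `T`-odd orientation iff `G` admits a good
`T`-decomposition. -/
theorem tOdd_iff_goodTDecomposition {V : Type*} [Fintype V] (G : SimpleGraph V)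
    (T : Set V) :
    HasAcyclicTOddOrientation G T ↔
      ∃ (k : ℕ) (A : Fin (k + 1) → Set V), GoodTDecomposition G T A := by
  exact ⟨fun h => ⟨0, _, goodTDecomposition_const_univ h⟩,
    fun ⟨_, _, h⟩ => h.hasAcyclicTOddOrientation⟩
end

section
/- Lemma (parity of decompositions): Let G be a finite simple graph and T ⊆ V(G) with |E(G)| + |T| even. Let ⟨V_0, …, V_k⟩ be a T-decomposition of G and let i ∈ {0,…,k}. If for every j ∈ {0,…,k} with j ≠ i the set T_j satisfies |E(G[V_j])| + |T_j| even, then T_i also satisfies |E(G[V_i])| + |T_i| even (where G[V_j] denotes the subgraph of G induced by V_j). -/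
open SimpleGraph

open Classical in
/-- The handshake lemma as a double sum over the adjacency indicator. -/
theorem two_mul_ncard_edgeSet {V : Type*} [Fintype V] (G : SimpleGraph V) :
    2 * G.edgeSet.ncard = ∑ u, ∑ v, if G.Adj u v then 1 else 0 := by
  have h := G.sum_degrees_eq_twice_card_edges
  rw [← SimpleGraph.coe_edgeFinset, Set.ncard_coe_finset, ← h]
  refine Finset.sum_congr rfl fun u _ => ?_
  rw [← SimpleGraph.card_neighborFinset_eq_degree, SimpleGraph.neighborFinset_eq_filter,
    Finset.card_filter]

open Classical in
/-- The handshake lemma for an induced subgraph, summed over the ambient vertex set. -/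
theorem two_mul_ncard_edgeSet_induce {V : Type*} [Fintype V] (G : SimpleGraph V) (s : Set V) :
    2 * (G.induce s).edgeSet.ncard =
      ∑ u, ∑ v, if G.Adj u v ∧ u ∈ s ∧ v ∈ s then 1 else 0 := by
  have key (f : V → ℕ) : ∑ x : s, f x = ∑ x, if x ∈ s then f x else 0 := by
    rw [← Finset.sum_filter]
    exact (Finset.sum_subtype _ (by simp) f).symm
  rw [two_mul_ncard_edgeSet]
  simp only [SimpleGraph.comap_adj, Function.Embedding.subtype_apply]
  rw [key fun u => ∑ v : s, if G.Adj u v then 1 else 0]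
  refine Finset.sum_congr rfl fun u _ => ?_
  rw [key fun v => if G.Adj u v then 1 else 0]
  by_cases hu : u ∈ s
  · rw [if_pos hu]
    refine Finset.sum_congr rfl fun v _ => ?_
    by_cases hv : v ∈ s <;> simp [hu, hv]
  · simp [hu]

open Classical in
/-- Every edge lies inside a fibre of `f` or goes from a smaller to a larger value of `f`. -/
theorem ncard_edgeSet_eq_sum_fibers {V ι : Type*} [Fintype V] [Fintype ι] [LinearOrder ι]
    (G : SimpleGraph V) (f : V → ι) :
    G.edgeSet.ncard = ∑ j, (G.induce {v | f v = j}).edgeSet.ncard +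
      ∑ v, {u | G.Adj u v ∧ f u < f v}.ncard := by
  have hb (v : V) : {u | G.Adj u v ∧ f u < f v}.ncard =
      ∑ u, if G.Adj u v ∧ f u < f v then 1 else 0 := by
    rw [← Finset.card_filter, ← Set.ncard_coe_finset]
    simp
  have hswap : ∑ v, ∑ u, (if G.Adj u v ∧ f u < f v then 1 else 0) =
      ∑ v, ∑ u, if G.Adj v u ∧ f v < f u then 1 else 0 := Finset.sum_comm
  have hin : ∑ j, 2 * (G.induce {v | f v = j}).edgeSet.ncard =
      ∑ v, ∑ u, if G.Adj v u ∧ f v = f u then 1 else 0 := by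
    simp only [two_mul_ncard_edgeSet_induce]
    rw [Finset.sum_comm]
    refine Finset.sum_congr rfl fun v _ => ?_
    rw [Finset.sum_comm]
    refine Finset.sum_congr rfl fun u _ => ?_
    refine (Finset.sum_eq_single (f v) (fun j _ hj => ?_) (by simp)).trans ?_
    · exact if_neg fun h => hj h.2.1.symm
    · simp [eq_comm]
  have hall : 2 * G.edgeSet.ncard = ∑ v, ∑ u, (if G.Adj v u ∧ f v = f u then 1 else 0) +
      ∑ v, ∑ u, (if G.Adj u v ∧ f u < f v then 1 else 0) +
      ∑ v, ∑ u, (if G.Adj v u ∧ f v < f u then 1 else 0) := by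
    rw [two_mul_ncard_edgeSet]
    simp only [← Finset.sum_add_distrib]
    refine Finset.sum_congr rfl fun v _ => Finset.sum_congr rfl fun u _ => ?_
    rw [G.adj_comm u v]
    rcases lt_trichotomy (f v) (f u) with h | h | h
    · simp [h, h.ne, h.not_gt]
    · simp [h]
    · simp [h, h.ne', h.not_gt]
  simp only [hb]
  rw [← Finset.mul_sum] at hin
  omega

/-- The cardinality of a symmetric difference is the sum of the cardinalities modulo two. -/
theorem even_ncard_symmDiff_add {α : Type*} [Finite α] (s t : Set α) :
    Even ((symmDiff s t).ncard + (s.ncard + t.ncard)) := by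
  have h : (symmDiff s t).ncard = (s \ t).ncard + (t \ s).ncard :=
    Set.ncard_union_eq disjoint_sdiff_sdiff
  have hs := Set.ncard_inter_add_ncard_sdiff_eq_ncard s t
  have ht := Set.ncard_inter_add_ncard_sdiff_eq_ncard t s
  rw [Set.inter_comm] at ht
  rw [h, ← hs, ← ht]
  exact ⟨(s ∩ t).ncard + (s \ t).ncard + (t \ s).ncard, by ring⟩

/-- A set is partitioned by the fibres of a function. -/
theorem ncard_eq_sum_fibers {V ι : Type*} [Fintype V] [Fintype ι]
    (f : V → ι) (s : Set V) : s.ncard = ∑ j, {v | v ∈ s ∧ f v = j}.ncard := by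
  classical
  rw [Set.ncard_eq_toFinset_card', Finset.card_eq_sum_card_fiberwise (f := f)
    (t := Finset.univ) (by simp [Set.MapsTo])]
  refine Finset.sum_congr rfl fun j _ => ?_
  rw [← Set.ncard_coe_finset]
  simp

/-- Lemma: in a `T`-decomposition of `(G, T)` with `T` satisfying `𝒫`, if all parts
but possibly one satisfy `𝒫`, then the remaining part does as well. -/
theorem decomposition_parity {V : Type*} [Fintype V] (G : SimpleGraph V) (T : Set V)
    (hT : Even (G.edgeSet.ncard + T.ncard)) {k : ℕ} (A : Fin (k + 1) → Set V)
    (hdisj : Pairwise (Function.onFun Disjoint A)) (hcov : (⋃ i, A i) = Set.univ)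
    (i : Fin (k + 1))
    (hj : ∀ j : Fin (k + 1), j ≠ i →
      Even ((G.induce (A j)).edgeSet.ncard + (symmDiff (decompZ G A j) (T ∩ A j)).ncard)) :
    Even ((G.induce (A i)).edgeSet.ncard + (symmDiff (decompZ G A i) (T ∩ A i)).ncard) := by
  classical
  have hex (v : V) : ∃ j, v ∈ A j := Set.mem_iUnion.1 (hcov ▸ Set.mem_univ v)
  choose f hf using hex
  have hmem (v : V) (j) : v ∈ A j ↔ f v = j := by
    refine ⟨fun h => ?_, fun h => h ▸ hf v⟩
    by_contra hne
    exact Set.disjoint_left.1 (hdisj hne) (hf v) h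
  have hA (j) : A j = {v | f v = j} := Set.ext fun v => hmem v j
  set b : V → ℕ := fun v => {u | G.Adj u v ∧ f u < f v}.ncard with hb
  have hZ (j) : decompZ G A j = {v | v ∈ {v | Odd (b v)} ∧ f v = j} := by
    ext v
    simp only [decompZ, hmem, Set.mem_ofPred_eq, hb]
    constructor
    · rintro ⟨rfl, h⟩
      simpa using h
    · rintro ⟨h, rfl⟩
      simpa using h
  have hTj (j) : T ∩ A j = {v | v ∈ T ∧ f v = j} := by
    rw [hA]; rfl
  have hE := ncard_edgeSet_eq_sum_fibers G f
  have hbodd : Even (∑ v, b v + {v | Odd (b v)}.ncard) := by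
    have h := Finset.even_sum_iff_even_card_odd (s := Finset.univ) b
    rw [Nat.even_add, h, ← Set.ncard_coe_finset]
    simp
  have hsymm : Even (∑ j, (symmDiff (decompZ G A j) (T ∩ A j)).ncard +
      ({v | Odd (b v)}.ncard + T.ncard)) := by
    rw [ncard_eq_sum_fibers f T, ncard_eq_sum_fibers f {v | Odd (b v)},
      ← Finset.sum_add_distrib, ← Finset.sum_add_distrib]
    refine Finset.even_sum _ fun j _ => ?_
    rw [hZ, hTj]
    exact even_ncard_symmDiff_add _ _
  have htotal : Even (∑ j, ((G.induce (A j)).edgeSet.ncard +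
      (symmDiff (decompZ G A j) (T ∩ A j)).ncard)) := by
    have hEA : ∑ j, (G.induce (A j)).edgeSet.ncard =
        ∑ j, (G.induce {v | f v = j}).edgeSet.ncard :=
      Finset.sum_congr rfl fun j _ => by rw [hA]
    rw [Finset.sum_add_distrib, hEA]
    change _ = _ + ∑ v, b v at hE
    grind
  rw [← Finset.add_sum_erase _ _ (Finset.mem_univ i)] at htotal
  exact (Nat.even_add.1 htotal).2
    (Finset.even_sum _ fun j hji => hj j (Finset.ne_of_mem_erase hji))
end

section
/- Lemma (grids with a non-bad boundary path): Let G = P_p □ P_q be a grid with p, q ≥ 1 and let T ⊆ V(G) satisfy condition P. If at least one of the four boundary paths of G, together with the trace of T on its vertices, is not a bad path instance, then G admits an acyclic T-odd orientation. -/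
open SimpleGraph

theorem zmod_two_eq_zero_or_one : ∀ x : ZMod 2, x = 0 ∨ x = 1 := by decide

open Classical in
/-- The number, modulo two, of neighbours of `v` in `S`. -/
noncomputable def nbrParity {V : Type*} (G : SimpleGraph V) (S : Finset V) (v : V) : ZMod 2 :=
  ∑ u ∈ S, if G.Adj u v then 1 else 0

open Classical in
/-- The subgraph of `G` induced on `S` has an acyclic orientation, given by a height function,
whose in-degrees are congruent to `t` modulo two. -/
def Realizable {V : Type*} (G : SimpleGraph V) (S : Finset V) (t : V → ZMod 2) : Prop :=
  ∃ f : V → ℤ, (∀ u ∈ S, ∀ v ∈ S, G.Adj u v → f u ≠ f v) ∧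
    ∀ v ∈ S, ∑ u ∈ S, (if G.Adj u v ∧ f u < f v then (1 : ZMod 2) else 0) = t v

section Realizable

variable {V : Type*} {G : SimpleGraph V} {S B R : Finset V} {t t' : V → ZMod 2}

theorem Realizable.congr (h : Realizable G S t) (htt' : ∀ v ∈ S, t v = t' v) :
    Realizable G S t' := by
  obtain ⟨f, hf, hs⟩ := h
  exact ⟨f, hf, fun v hv => (hs v hv).trans (htt' v hv)⟩

theorem realizable_empty : Realizable G ∅ t := ⟨0, by simp, by simp⟩

theorem realizable_singleton {v : V} (h : t v = 0) : Realizable G {v} t :=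
  ⟨0, by simp, by simp [h]⟩

theorem nbrParity_singleton (u v : V) [Decidable (G.Adj u v)] :
    nbrParity G {u} v = if G.Adj u v then 1 else 0 := by
  simp only [nbrParity, Finset.sum_singleton]
  congr

theorem nbrParity_union [DecidableEq V] (h : Disjoint B R) (v : V) :
    nbrParity G (B ∪ R) v = nbrParity G B v + nbrParity G R v :=
  Finset.sum_union h

theorem nbrParity_eq_one {v u : V} (hu : u ∈ S) (h : ∀ w ∈ S, G.Adj w v ↔ w = u) :
    nbrParity G S v = 1 := by
  classical
  rw [nbrParity, Finset.sum_congr rfl fun w hw => if_congr (h w hw) rfl rfl]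
  simp [hu]

theorem nbrParity_eq_zero {v : V} (h : ∀ w ∈ S, ¬ G.Adj w v) : nbrParity G S v = 0 :=
  Finset.sum_eq_zero fun w hw => if_neg (h w hw)

theorem Realizable.union_left [DecidableEq V] (hd : Disjoint B R) (hB : Realizable G B t)
    (hR : Realizable G R fun v => t v + nbrParity G B v) : Realizable G (B ∪ R) t := by
  classical
  obtain ⟨f, hf, hfs⟩ := hB
  obtain ⟨g, hg, hgs⟩ := hR
  obtain ⟨M, hM⟩ := ((B ×ˢ R).image fun x => f x.1 - g x.2 + 1).exists_le
  have hlt : ∀ u ∈ B, ∀ v ∈ R, f u < g v + M := fun u hu v hv => by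
    have := hM _ (Finset.mem_image_of_mem _ (Finset.mk_mem_product hu hv))
    dsimp only at this
    omega
  have hnot : ∀ v ∈ R, v ∉ B := fun v hv hv' => Finset.disjoint_left.1 hd hv' hv
  refine ⟨fun v => if v ∈ B then f v else g v + M, ?_, ?_⟩
  · intro u hu v hv huv
    rcases Finset.mem_union.1 hu with hu | hu <;> rcases Finset.mem_union.1 hv with hv | hv
    · simpa [hu, hv] using hf u hu v hv huv
    · simpa [hu, hnot v hv] using (hlt u hu v hv).ne
    · simpa [hv, hnot u hu] using (hlt v hv u hu).ne'
    · simpa [hnot u hu, hnot v hv] using hg u hu v hv huv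
  · intro v hv
    rw [Finset.sum_union hd]
    rcases Finset.mem_union.1 hv with hv | hv
    · rw [← hfs v hv, Finset.sum_eq_zero (s := R), add_zero]
      · exact Finset.sum_congr rfl fun u hu => by simp [hu, hv]
      · intro u hu
        simp [hv, hnot u hu, (hlt v hv u hu).le]
    · have h1 : nbrParity G B v = ∑ u ∈ B, if G.Adj u v ∧
          (if u ∈ B then f u else g u + M) < (if v ∈ B then f v else g v + M) then 1 else 0 :=
        Finset.sum_congr rfl fun u hu => by simp [hu, hnot v hv, hlt u hu v hv]
      have h2 : ∑ u ∈ R, (if G.Adj u v ∧ g u < g v then (1 : ZMod 2) else 0) =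
          ∑ u ∈ R, if G.Adj u v ∧
            (if u ∈ B then f u else g u + M) < (if v ∈ B then f v else g v + M) then 1 else 0 :=
        Finset.sum_congr rfl fun u hu => by simp [hnot u hu, hnot v hv]
      have h3 := hgs v hv
      rw [← h1, ← h2, h3]
      grind

/-- If `d = 1` the edges between `B` and `R` are directed towards `R`, and if `d = 0` they are
directed towards `B`. -/
theorem Realizable.union [DecidableEq V] (d : ZMod 2) (hd : Disjoint B R)
    (hB : Realizable G B fun v => t v + (1 + d) * nbrParity G R v)
    (hR : Realizable G R fun v => t v + d * nbrParity G B v) : Realizable G (B ∪ R) t := by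
  obtain rfl | rfl : d = 0 ∨ d = 1 := zmod_two_eq_zero_or_one d
  · rw [Finset.union_comm]
    exact .union_left hd.symm (hR.congr fun v _ => by simp) (hB.congr fun v _ => by simp)
  · exact .union_left hd (hB.congr fun v _ => by grind) (hR.congr fun v _ => by simp)

end Realizable
/-- The infinite quarter-plane grid. -/
def latticeGraph : SimpleGraph (ℕ × ℕ) := hasse ℕ □ hasse ℕ

theorem latticeGraph_adj {a b c d : ℕ} : latticeGraph.Adj (a, b) (c, d) ↔
    (a + 1 = c ∨ c + 1 = a) ∧ b = d ∨ (b + 1 = d ∨ d + 1 = b) ∧ a = c := by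
  simp [latticeGraph]

/-- The vertices `(c, j)` with `a ≤ j < q`. -/
def gridColumn (c a q : ℕ) : Finset (ℕ × ℕ) := {c} ×ˢ Finset.Ico a q

/-- The vertices `(i, j)` with `i < n` and `j < q`. -/
def gridRect (n q : ℕ) : Finset (ℕ × ℕ) := Finset.range n ×ˢ Finset.range q

theorem mem_gridColumn {c a q i j : ℕ} : (i, j) ∈ gridColumn c a q ↔ i = c ∧ a ≤ j ∧ j < q := by
  simp [gridColumn, and_comm, eq_comm]

theorem mem_gridRect {n q i j : ℕ} : (i, j) ∈ gridRect n q ↔ i < n ∧ j < q := by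
  simp [gridRect]

theorem gridRect_succ (n q : ℕ) : gridRect (n + 1) q = gridColumn n 0 q ∪ gridRect n q := by
  ext ⟨i, j⟩
  simp only [Finset.mem_union, mem_gridColumn, mem_gridRect]
  omega

theorem gridColumn_succ {a q : ℕ} (c : ℕ) (h : a < q) :
    gridColumn c a q = {(c, a)} ∪ gridColumn c (a + 1) q := by
  ext ⟨i, j⟩
  simp only [Finset.mem_union, Finset.mem_singleton, Prod.mk.injEq, mem_gridColumn]
  omega

theorem nbrParity_gridColumn_below {c a q : ℕ} (h : a + 1 < q) :
    nbrParity latticeGraph (gridColumn c (a + 1) q) (c, a) = 1 :=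
  nbrParity_eq_one (u := (c, a + 1)) (by simp [mem_gridColumn, h]) fun ⟨i, j⟩ hw => by
    simp only [mem_gridColumn, latticeGraph_adj, Prod.mk.injEq] at *
    omega

theorem nbrParity_gridColumn_side {c c' a q j : ℕ} (hc : c + 1 = c' ∨ c' + 1 = c) :
    nbrParity latticeGraph (gridColumn c a q) (c', j) = if a ≤ j ∧ j < q then 1 else 0 := by
  split_ifs with h
  · refine nbrParity_eq_one (u := (c, j)) (by simp [mem_gridColumn, h]) fun ⟨i, j⟩ hw => ?_
    simp only [mem_gridColumn, latticeGraph_adj, Prod.mk.injEq] at *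
    omega
  · refine nbrParity_eq_zero fun ⟨i, j⟩ hw => ?_
    simp only [mem_gridColumn, latticeGraph_adj] at *
    omega

theorem nbrParity_gridColumn_far {c c' a q j : ℕ} (hc : c' + 1 < c) :
    nbrParity latticeGraph (gridColumn c a q) (c', j) = 0 := by
  refine nbrParity_eq_zero fun ⟨i, j⟩ hw => ?_
  simp only [mem_gridColumn, latticeGraph_adj] at *
  omega

theorem nbrParity_gridRect {n m q j : ℕ} (hm : n ≤ m) (hj : j < q) :
    nbrParity latticeGraph (gridRect n q) (m, j) = if 0 < n ∧ n = m then 1 else 0 := by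
  split_ifs with h
  · refine nbrParity_eq_one (u := (n - 1, j)) (by simp [mem_gridRect]; omega) fun ⟨i, j⟩ hw => ?_
    simp only [mem_gridRect, latticeGraph_adj, Prod.mk.injEq] at *
    omega
  · refine nbrParity_eq_zero fun ⟨i, j⟩ hw => ?_
    simp only [mem_gridRect, latticeGraph_adj] at *
    omega

theorem nbrParity_lattice_singleton (a b c d : ℕ) : nbrParity latticeGraph {(a, b)} (c, d) =
    if (a + 1 = c ∨ c + 1 = a) ∧ b = d ∨ (b + 1 = d ∨ d + 1 = b) ∧ a = c then 1 else 0 := by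
  classical
  rw [nbrParity_singleton, if_congr latticeGraph_adj rfl rfl]

theorem realizable_gridColumn {c q : ℕ} : ∀ {a : ℕ} {t : ℕ × ℕ → ZMod 2}, a < q →
    ∑ j ∈ Finset.Ico a q, t (c, j) = (q + a + 1 : ℕ) →
    Realizable latticeGraph (gridColumn c a q) t := by
  intro a t haq
  induction hk : q - a - 1 generalizing a t with
  | zero =>
    obtain rfl : q = a + 1 := by omega
    intro h
    rw [gridColumn_succ c haq, show gridColumn c (a + 1) (a + 1) = ∅ by simp [gridColumn]]
    simp only [Nat.Ico_succ_singleton, Finset.sum_singleton] at h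
    refine realizable_singleton ?_
    push_cast at h
    grind
  | succ k ih =>
    intro h
    have ha : a + 1 < q := by omega
    rw [Finset.sum_eq_sum_Ico_succ_bot haq] at h
    rw [gridColumn_succ c haq]
    refine .union (1 + t (c, a)) (by simp [mem_gridColumn]) (realizable_singleton ?_)
      (ih ha (by omega) ?_)
    · rw [nbrParity_gridColumn_below ha]
      grind
    · have hs : ∑ j ∈ Finset.Ico (a + 1) q, nbrParity latticeGraph {(c, a)} (c, j) = 1 := by
        rw [Finset.sum_eq_sum_Ico_succ_bot ha, nbrParity_lattice_singleton, if_pos (by omega),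
          Finset.sum_eq_zero, add_zero]
        intro j hj
        rw [Finset.mem_Ico] at hj
        rw [nbrParity_lattice_singleton, if_neg (by omega)]
      rw [Finset.sum_add_distrib, ← Finset.mul_sum, hs]
      push_cast at h ⊢
      grind

theorem realizable_gridRect_succ_of_column {n q : ℕ} {t : ℕ × ℕ → ZMod 2} (hq : 0 < q)
    (d : ZMod 2) (hcol : ∑ j ∈ Finset.range q, t (n, j) =
      q + 1 + (1 + d) * if 0 < n then q else 0)
    (h : Realizable latticeGraph (gridRect n q) fun v => t v + if v.1 + 1 = n then d else 0) :
    Realizable latticeGraph (gridRect (n + 1) q) t := by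
  rw [gridRect_succ]
  refine .union d ?_ (realizable_gridColumn hq ?_) (h.congr ?_)
  · rw [Finset.disjoint_left]
    rintro ⟨i, j⟩
    simp only [mem_gridColumn, mem_gridRect]
    omega
  · rw [Nat.Ico_zero_eq_range, Finset.sum_add_distrib, hcol, ← Finset.mul_sum,
      Finset.sum_congr rfl fun j hj =>
        nbrParity_gridRect (n := n) le_rfl (Finset.mem_range.1 hj)]
    rcases Nat.eq_zero_or_pos n with rfl | hn
    · simp
    · simp [hn]
      grind
  · rintro ⟨i, j⟩ hv
    rw [mem_gridRect] at hv
    dsimp only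
    split_ifs with hi
    · rw [nbrParity_gridColumn_side (.inr hi), if_pos (by omega), mul_one]
    · rw [nbrParity_gridColumn_far (by omega), mul_zero]

theorem realizable_gridRect_of_odd {q : ℕ} (hq : Odd q) (n : ℕ) : ∀ {t : ℕ × ℕ → ZMod 2},
    ∑ i ∈ Finset.range (n + 1), ∑ j ∈ Finset.range q, t (i, j) = n →
    Realizable latticeGraph (gridRect (n + 1) q) t := by
  have hq1 : (q : ZMod 2) = 1 := (ZMod.natCast_eq_one_iff_odd).2 hq
  induction n with
  | zero =>
    intro t h
    refine realizable_gridRect_succ_of_column hq.pos 0 ?_ (by simpa [gridRect] using realizable_empty)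
    simp only [zero_add, Finset.sum_range_one] at h
    rw [h, hq1]
    simp
    decide
  | succ n ih =>
    intro t h
    rw [Finset.sum_range_succ] at h
    refine realizable_gridRect_succ_of_column hq.pos
      (1 + ∑ j ∈ Finset.range q, t (n + 1, j)) ?_ (ih ?_)
    · simp only [hq1, Nat.zero_lt_succ, if_true]
      grind
    · simp only [Finset.sum_add_distrib]
      rw [Finset.sum_range_succ (n := n) (f := fun i => ∑ j ∈ Finset.range q, ite _ _ _)]
      rw [Finset.sum_eq_zero (s := Finset.range n)]
      · simp [hq1]
        push_cast at h
        grind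
      · intro i hi
        rw [Finset.mem_range] at hi
        simp [hi.ne]

theorem realizable_gridColumn_union_gridRect {m q : ℕ} {t : ℕ × ℕ → ZMod 2} (hq : Even q)
    (hq0 : 1 < q) (d : ZMod 2) (hd : d = ∑ j ∈ Finset.Ico 1 q, t (m + 1, j) + 1)
    (h : Realizable latticeGraph (gridRect (m + 1) q) fun v =>
      t v + if v.1 = m then if v.2 = 0 then 0 else d else 0) :
    Realizable latticeGraph (gridColumn (m + 1) 1 q ∪ gridRect (m + 1) q) t := by
  have hq2 : (q : ZMod 2) = 0 := (ZMod.natCast_eq_zero_iff_even).2 hq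
  refine .union d ?_ (realizable_gridColumn hq0 ?_) (h.congr ?_)
  · rw [Finset.disjoint_left]
    rintro ⟨i, j⟩
    simp only [mem_gridColumn, mem_gridRect]
    omega
  · rw [Finset.sum_add_distrib, ← Finset.mul_sum, Finset.sum_congr rfl fun j hj =>
      nbrParity_gridRect (n := m + 1) le_rfl (Finset.mem_Ico.1 hj).2]
    simp [Nat.cast_sub hq0.le, hq2]
    grind
  · rintro ⟨i, j⟩ hv
    rw [mem_gridRect] at hv
    dsimp only
    by_cases hi : i = m
    · rw [nbrParity_gridColumn_side (by omega)]
      by_cases hj : j = 0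
      · simp [hj]
      · rw [if_pos hi, if_neg hj, if_pos (by omega), mul_one]
    · rw [nbrParity_gridColumn_far (by omega), if_neg hi, mul_zero]

/-- If the corner `(m + 1, 0)` has even target, it can be made a source or a sink, and then the
rest of its column can be oriented. -/
theorem realizable_gridRect_of_corner {m q : ℕ} {t : ℕ × ℕ → ZMod 2} (hq : Even q)
    (hq0 : 1 < q) (hc : t (m + 1, 0) = 0) (d e : ZMod 2)
    (he : e = ∑ j ∈ Finset.Ico 1 q, t (m + 1, j) + d + 1)
    (h : Realizable latticeGraph (gridRect (m + 1) q) fun v =>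
      t v + if v.1 = m then if v.2 = 0 then d else e else 0) :
    Realizable latticeGraph (gridRect (m + 2) q) t := by
  rw [gridRect_succ, gridColumn_succ _ (by omega), Finset.union_assoc]
  refine .union d ?_ (realizable_singleton ?_)
    (realizable_gridColumn_union_gridRect hq hq0 e ?_ (h.congr ?_))
  · simp [mem_gridColumn, mem_gridRect]
  · rw [nbrParity_union, nbrParity_gridColumn_below (by omega),
      nbrParity_gridRect le_rfl (by omega), if_pos (by omega), hc]
    · grind
    · rw [Finset.disjoint_left]
      rintro ⟨i, j⟩
      simp only [mem_gridColumn, mem_gridRect]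
      omega
  · have hs : ∑ j ∈ Finset.Ico 1 q, nbrParity latticeGraph {(m + 1, 0)} (m + 1, j) = 1 := by
      rw [Finset.sum_eq_sum_Ico_succ_bot hq0, nbrParity_lattice_singleton, if_pos (by omega),
        Finset.sum_eq_zero, add_zero]
      intro j hj
      rw [Finset.mem_Ico] at hj
      rw [nbrParity_lattice_singleton, if_neg (by omega)]
    rw [Finset.sum_add_distrib, ← Finset.mul_sum, hs, he]
    ring
  · rintro ⟨i, j⟩ hv
    rw [mem_gridRect] at hv
    dsimp only
    rw [nbrParity_lattice_singleton]
    split_ifs <;> first | omega | simp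

/-- If the targets in column `n + 1` have the wrong parity, that column can be oriented after
making `(n, 0)` a source or a sink. -/
theorem realizable_gridRect_of_inner_corner {n q : ℕ} {t : ℕ × ℕ → ZMod 2} (hq : Even q)
    (hq0 : 1 < q) (d : ZMod 2) (hcol : ∑ j ∈ Finset.range q, t (n + 1, j) = 0)
    (hc : t (n, 0) + (1 + d) * (if 0 < n then 1 else 0) = 0)
    (h : Realizable latticeGraph (gridColumn n 1 q ∪ gridRect n q) fun v =>
      t v + if v.1 = n then if v.2 = 1 then 0 else d
        else if v.1 + 1 = n ∧ v.2 = 0 then d else 0) :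
    Realizable latticeGraph (gridRect (n + 2) q) t := by
  have hq2 : (q : ZMod 2) = 0 := (ZMod.natCast_eq_zero_iff_even).2 hq
  have hset : gridRect (n + 2) q =
      {(n, 0)} ∪ (gridColumn (n + 1) 0 q ∪ (gridColumn n 1 q ∪ gridRect n q)) := by
    ext ⟨i, j⟩
    simp only [Finset.mem_union, Finset.mem_singleton, Prod.mk.injEq, mem_gridColumn,
      mem_gridRect]
    omega
  have hd₁ : Disjoint (gridColumn n 1 q) (gridRect n q) := by
    rw [Finset.disjoint_left]
    rintro ⟨i, j⟩
    simp only [mem_gridColumn, mem_gridRect]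
    omega
  have hd₂ : Disjoint (gridColumn (n + 1) 0 q) (gridColumn n 1 q ∪ gridRect n q) := by
    rw [Finset.disjoint_left]
    rintro ⟨i, j⟩
    simp only [Finset.mem_union, mem_gridColumn, mem_gridRect]
    omega
  rw [hset]
  refine .union d ?_ (realizable_singleton ?_)
    (.union d hd₂ (realizable_gridColumn (by omega) ?_) (h.congr ?_))
  · simp [mem_gridColumn, mem_gridRect]
  · rw [nbrParity_union hd₂, nbrParity_union hd₁, nbrParity_gridColumn_below (by omega),
      nbrParity_gridRect le_rfl (by omega), nbrParity_gridColumn_side (by omega),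
      if_pos (by omega)]
    simp only [and_true] at hc ⊢
    grind
  · have hs₁ : ∑ j ∈ Finset.range q, nbrParity latticeGraph {(n, 0)} (n + 1, j) = 1 := by
      rw [Finset.sum_eq_single_of_mem 0 (by simp; omega), nbrParity_lattice_singleton,
        if_pos (by omega)]
      intro j _ hj
      rw [nbrParity_lattice_singleton, if_neg (by omega)]
    have hs₂ : ∑ j ∈ Finset.range q,
        nbrParity latticeGraph (gridColumn n 1 q ∪ gridRect n q) (n + 1, j) = 1 := by
      have : ∀ j ∈ Finset.range q, nbrParity latticeGraph (gridColumn n 1 q ∪ gridRect n q)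
          (n + 1, j) = 1 + if j = 0 then 1 else 0 := by
        intro j hj
        rw [Finset.mem_range] at hj
        rw [nbrParity_union hd₁, nbrParity_gridRect (by omega) hj, if_neg (by omega),
          nbrParity_gridColumn_side (by omega)]
        split_ifs <;> first | omega | clear * -; decide
      rw [Finset.sum_congr rfl this, Finset.sum_add_distrib]
      simp [hq2]
      omega
    rw [Nat.Ico_zero_eq_range, Finset.sum_add_distrib, Finset.sum_add_distrib, ← Finset.mul_sum,
      ← Finset.mul_sum, hs₁, hs₂, hcol]
    push_cast
    grind
  · rintro ⟨i, j⟩ hv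
    simp only [Finset.mem_union, mem_gridColumn, mem_gridRect] at hv
    dsimp only
    rw [nbrParity_lattice_singleton]
    by_cases hi : i = n
    · rw [nbrParity_gridColumn_side (by omega)]
      split_ifs <;> first | omega | grind
    · rw [nbrParity_gridColumn_far (by omega)]
      split_ifs <;> first | omega | grind

theorem sum_add_toggle_last_column {m q : ℕ} (hq : Even q) (hq0 : 1 < q) (t : ℕ × ℕ → ZMod 2)
    (d e : ZMod 2) : ∑ i ∈ Finset.range (m + 1), ∑ j ∈ Finset.range q,
      (t (i, j) + if i = m then if j = 0 then d else e else 0) =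
    ∑ i ∈ Finset.range (m + 1), ∑ j ∈ Finset.range q, t (i, j) + d + e := by
  obtain ⟨r, rfl⟩ := Nat.exists_eq_add_of_lt hq0
  have hr : ((1 + r + 1 : ℕ) : ZMod 2) = 0 := (ZMod.natCast_eq_zero_iff_even).2 hq
  have hs : ∑ j ∈ Finset.range (1 + r + 1), (if j = 0 then d else e) = d + e := by
    rw [Finset.sum_range_succ']
    simp
    push_cast at hr
    grind
  simp only [Finset.sum_add_distrib]
  rw [Finset.sum_range_succ (n := m)
    (f := fun i => ∑ j ∈ Finset.range (1 + r + 1), if i = m then if j = 0 then d else e else 0)]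
  rw [Finset.sum_eq_zero (s := Finset.range m)]
  · simp only [if_true, hs]
    ring
  · intro i hi
    rw [Finset.mem_range] at hi
    simp [hi.ne]

theorem sum_range_eq_add_sum_Ico {q : ℕ} (hq : 0 < q) (f : ℕ → ZMod 2) :
    ∑ j ∈ Finset.range q, f j = f 0 + ∑ j ∈ Finset.Ico 1 q, f j := by
  rw [Finset.range_eq_Ico, Finset.sum_eq_sum_Ico_succ_bot hq]

theorem realizable_gridRect_one {q : ℕ} (hq : Even q) (hq0 : 1 < q) {t : ℕ × ℕ → ZMod 2}
    (h : ∑ i ∈ Finset.range 1, ∑ j ∈ Finset.range q, t (i, j) = 1) :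
    Realizable latticeGraph (gridRect 1 q) t := by
  have hq2 : (q : ZMod 2) = 0 := (ZMod.natCast_eq_zero_iff_even).2 hq
  refine realizable_gridRect_succ_of_column (by omega) 0 ?_
    (by simpa [gridRect] using realizable_empty)
  rw [Finset.sum_range_one] at h
  simp [h, hq2]

theorem realizable_gridRect_of_corner_eq_zero {q : ℕ} (hq : Even q) (hq0 : 1 < q) (n : ℕ) :
    ∀ {t : ℕ × ℕ → ZMod 2}, t (n, 0) = 0 →
    ∑ i ∈ Finset.range (n + 1), ∑ j ∈ Finset.range q, t (i, j) = (n + 1 : ℕ) →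
    Realizable latticeGraph (gridRect (n + 1) q) t := by
  induction n with
  | zero =>
    intro t _ h
    exact realizable_gridRect_one hq hq0 (by simpa using h)
  | succ n ih =>
    intro t ht h
    refine realizable_gridRect_of_corner hq hq0 ht (t (n, 0)) _ rfl (ih ?_ ?_)
    · simp only [if_true]
      grind
    · rw [Finset.sum_range_succ, sum_range_eq_add_sum_Ico (by omega) fun j => t (n + 1, j)] at h
      rw [sum_add_toggle_last_column hq hq0]
      push_cast at h ⊢
      grind

theorem realizable_gridRect_of_sum_column_eq_one {n q : ℕ} (hq : Even q) (hq0 : 1 < q)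
    {t : ℕ × ℕ → ZMod 2} (hcol : ∑ j ∈ Finset.range q, t (n + 1, j) = 1)
    (h : ∑ i ∈ Finset.range (n + 2), ∑ j ∈ Finset.range q, t (i, j) = (n + 2 : ℕ)) :
    Realizable latticeGraph (gridRect (n + 2) q) t := by
  have hq2 : (q : ZMod 2) = 0 := (ZMod.natCast_eq_zero_iff_even).2 hq
  refine realizable_gridRect_succ_of_column (by omega) (t (n, 0)) (by simp [hcol, hq2])
    ((realizable_gridRect_of_corner_eq_zero hq hq0 n
      (t := fun v => t v + if v.1 = n then if v.2 = 0 then t (n, 0) else t (n, 0) else 0)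
      ?_ ?_).congr ?_)
  · simp only [if_true]
    grind
  · rw [sum_add_toggle_last_column hq hq0]
    rw [Finset.sum_range_succ] at h
    push_cast at h ⊢
    grind
  · rintro v -
    simp

/-- The path instance with targets `w 0, …, w (h - 1)` is bad. -/
def BadPathTarget (h : ℕ) (w : ℕ → ZMod 2) : Prop :=
  Even h ∧ w 0 = 1 ∧ w (h - 1) = 1 ∧ ∀ k, 1 ≤ k → 2 * k + 1 < h → w (2 * k - 1) = w (2 * k)

theorem realizable_gridRect_of_even {q : ℕ} (hq : Even q) (hq0 : 1 < q) (n : ℕ) :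
    ∀ {t : ℕ × ℕ → ZMod 2}, ¬ BadPathTarget n (fun i => t (i, 0)) →
    ∑ i ∈ Finset.range n, ∑ j ∈ Finset.range q, t (i, j) = n →
    Realizable latticeGraph (gridRect n q) t := by
  have hq2 : (q : ZMod 2) = 0 := (ZMod.natCast_eq_zero_iff_even).2 hq
  induction n using Nat.twoStepInduction with
  | zero =>
    intro t _ _
    simpa [gridRect] using realizable_empty
  | one =>
    intro t _ h
    exact realizable_gridRect_one hq hq0 (by simpa using h)
  | more n ih _ =>
    intro t hbad h
    obtain hc | hc : t (n + 1, 0) = 0 ∨ t (n + 1, 0) = 1 :=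
      zmod_two_eq_zero_or_one _
    · exact realizable_gridRect_of_corner_eq_zero hq hq0 _ hc h
    obtain hs | hs : ∑ j ∈ Finset.range q, t (n + 1, j) = 1 ∨
        ∑ j ∈ Finset.range q, t (n + 1, j) = 0 :=
      (zmod_two_eq_zero_or_one _).symm
    · exact realizable_gridRect_of_sum_column_eq_one hq hq0 hs h
    have h_two : ((n + 2 : ℕ) : ZMod 2) = n := by
      push_cast
      grind
    rw [Finset.sum_range_succ, Finset.sum_range_succ, hs,
      sum_range_eq_add_sum_Ico (by omega) fun j => t (n, j), h_two] at h
    rcases n with _ | m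
    · have h0 : t (0, 0) = 0 := (zmod_two_eq_zero_or_one _).resolve_right fun h0 =>
        hbad ⟨by simp, h0, hc, fun k _ _ => by omega⟩
      refine realizable_gridRect_of_inner_corner hq hq0 1 hs (by simp [h0]) ?_
      rw [show gridRect 0 q = ∅ by simp [gridRect], Finset.union_empty]
      refine realizable_gridColumn hq0 ?_
      have : ∑ j ∈ Finset.Ico 1 q, (if j = 1 then (0 : ZMod 2) else 1) = q := by
        rw [Finset.sum_eq_sum_Ico_succ_bot hq0, if_pos rfl, Finset.sum_congr rfl fun j hj =>
          if_neg (by rw [Finset.mem_Ico] at hj; omega)]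
        rw [Finset.sum_const, Nat.card_Ico, nsmul_one, Nat.cast_sub (show 1 + 1 ≤ q from hq0)]
        push_cast
        linear_combination -(CharTwo.two_eq_zero : (2 : ZMod 2) = 0)
      simp only [if_true, Finset.sum_add_distrib]
      simp only [Finset.range_zero, Finset.sum_empty, h0, zero_add, add_zero, Nat.cast_zero] at h
      rw [h, this, hq2]
      push_cast
      linear_combination -hq2 - (CharTwo.two_eq_zero : (2 : ZMod 2) = 0)
    · refine realizable_gridRect_of_inner_corner hq hq0 (1 + t (m + 1, 0)) hs ?_
        (realizable_gridColumn_union_gridRect hq hq0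
          (∑ j ∈ Finset.Ico 1 q, t (m + 1, j) + 1) ?_
          ((ih (t := fun v => t v + if v.1 = m then if v.2 = 0 then 1 + t (m + 1, 0)
            else ∑ j ∈ Finset.Ico 1 q, t (m + 1, j) + 1 else 0) ?_ ?_).congr ?_))
      · rw [if_pos m.succ_pos]
        linear_combination (1 + t (m + 1, 0)) * (CharTwo.two_eq_zero : (2 : ZMod 2) = 0)
      · have : ∑ j ∈ Finset.Ico 1 q, (if j = 1 then (0 : ZMod 2) else 1 + t (m + 1, 0)) = 0 := by
          rw [Finset.sum_eq_sum_Ico_succ_bot hq0, if_pos rfl, Finset.sum_congr rfl fun j hj =>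
            if_neg (by rw [Finset.mem_Ico] at hj; omega)]
          rw [Finset.sum_const, Nat.card_Ico, nsmul_eq_mul,
            Nat.cast_sub (show 1 + 1 ≤ q from hq0), hq2]
          push_cast
          linear_combination -(1 + t (m + 1, 0)) * (CharTwo.two_eq_zero : (2 : ZMod 2) = 0)
        simp only [if_true, Finset.sum_add_distrib, this, add_zero]
      · rintro ⟨heven, hfst, hlast, hpairs⟩
        have hm : m ≠ 0 := by
          rintro rfl
          exact absurd heven (by decide)
        have hlast' : t (m, 0) = t (m + 1, 0) := by
          simp only [Nat.add_sub_cancel, if_true] at hlast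
          grind
        refine hbad ⟨by simpa [Nat.even_add] using heven, ?_, hc, fun k hk hk' => ?_⟩
        · simpa [hm.symm] using hfst
        · rcases Nat.lt_or_ge (2 * k + 1) (m + 1) with hlt | hge
          · have := hpairs k hk hlt
            simpa [show 2 * k - 1 ≠ m by omega, show 2 * k ≠ m by omega] using this
          · obtain ⟨r, hr⟩ := heven
            obtain rfl : m = 2 * k - 1 := by omega
            simpa [show 2 * k - 1 + 1 = 2 * k by omega] using hlast'
      · rw [sum_add_toggle_last_column hq hq0]
        push_cast at h ⊢
        grind
      · rintro ⟨i, j⟩ hv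
        rw [mem_gridRect] at hv
        dsimp only
        split_ifs <;> first | omega | grind

section Transfer

variable {p q : ℕ}

open Classical in
/-- The indicator function of `T`, extended by zero to `ℕ × ℕ`. -/
noncomputable def gridTarget (T : Set (Fin p × Fin q)) (v : ℕ × ℕ) : ZMod 2 :=
  if ∃ (hi : v.1 < p) (hj : v.2 < q), (⟨v.1, hi⟩, ⟨v.2, hj⟩) ∈ T then 1 else 0

open Classical in
theorem gridTarget_val (T : Set (Fin p × Fin q)) (i : Fin p) (j : Fin q) :
    gridTarget T (i, j) = if (i, j) ∈ T then 1 else 0 := by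
  simp [gridTarget]

theorem gridTarget_eq_one_iff (T : Set (Fin p × Fin q)) (i j : ℕ) :
    gridTarget T (i, j) = 1 ↔ ∃ (hi : i < p) (hj : j < q), (⟨i, hi⟩, ⟨j, hj⟩) ∈ T := by
  simp [gridTarget]

theorem sum_gridRect_eq_sum_univ (f : ℕ × ℕ → ZMod 2) :
    ∑ v ∈ gridRect p q, f v = ∑ v : Fin p × Fin q, f (v.1, v.2) := by
  rw [gridRect, Finset.sum_product, Fintype.sum_prod_type, Finset.sum_range]
  exact Finset.sum_congr rfl fun i _ => Finset.sum_range _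

theorem natCast_ncard_eq_sum {α : Type*} [Fintype α] (s : Set α) [DecidablePred (· ∈ s)] :
    (s.ncard : ZMod 2) = ∑ x, if x ∈ s then 1 else 0 := by
  rw [Set.ncard_eq_toFinset_card', Finset.sum_boole]
  congr 2
  ext
  simp

theorem sum_gridTarget (T : Set (Fin p × Fin q)) :
    ∑ i ∈ Finset.range p, ∑ j ∈ Finset.range q, gridTarget T (i, j) = T.ncard := by
  classical
  rw [natCast_ncard_eq_sum, ← Finset.sum_product', ← gridRect, sum_gridRect_eq_sum_univ]
  exact Finset.sum_congr rfl fun v _ => gridTarget_val T v.1 v.2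

theorem boxProd_pathGraph_adj {u v : Fin p × Fin q} : (pathGraph p □ pathGraph q).Adj u v ↔
    latticeGraph.Adj (u.1, u.2) (v.1, v.2) := by
  rw [latticeGraph_adj, boxProd_adj, pathGraph_adj, pathGraph_adj, Fin.ext_iff, Fin.ext_iff]

theorem Realizable.hasAcyclicTOddOrientation {T : Set (Fin p × Fin q)}
    (h : Realizable latticeGraph (gridRect p q) (gridTarget T)) :
    HasAcyclicTOddOrientation (pathGraph p □ pathGraph q) T := by
  classical
  obtain ⟨f, hf, hs⟩ := h
  have hmem : ∀ v : Fin p × Fin q, ((v.1 : ℕ), (v.2 : ℕ)) ∈ gridRect p q := fun v =>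
    mem_gridRect.2 ⟨v.1.2, v.2.2⟩
  refine ⟨⟨fun u v => (pathGraph p □ pathGraph q).Adj u v ∧ f (u.1, u.2) < f (v.1, v.2),
    fun _ _ h => h.1, fun u v huv => ?_⟩, ?_, fun v => ?_⟩
  · have := hf _ (hmem u) _ (hmem v) (boxProd_pathGraph_adj.1 huv)
    simp only [huv, huv.symm, true_and]
    omega
  · have key : ∀ u v, Relation.TransGen (fun u v : Fin p × Fin q =>
        (pathGraph p □ pathGraph q).Adj u v ∧ f (u.1, u.2) < f (v.1, v.2)) u v →
        f (u.1, u.2) < f (v.1, v.2) := by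
      intro u v h
      induction h with
      | single h => exact h.2
      | tail _ h ih => exact ih.trans h.2
    exact fun v hv => (key v v hv).false
  · have h := hs _ (hmem v)
    rw [sum_gridRect_eq_sum_univ, gridTarget_val] at h
    rw [GraphOrientation.indeg, ← ZMod.natCast_eq_one_iff_odd, natCast_ncard_eq_sum]
    simp only [Set.mem_ofPred_eq, boxProd_pathGraph_adj]
    rw [h]
    simp

theorem card_edgeFinset_pathGraph (n : ℕ) [DecidableRel (pathGraph (n + 1)).Adj] :
    (pathGraph (n + 1)).edgeFinset.card = n := by
  have hdeg : ∀ i : Fin (n + 1), (pathGraph (n + 1)).degree i =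
      (if i = Fin.last n then 0 else 1) + if i = 0 then 0 else 1 := by
    intro i
    have hset : (pathGraph (n + 1)).neighborFinset i =
        (Finset.univ.filter fun j => i.val + 1 = j.val) ∪
          Finset.univ.filter fun j => j.val + 1 = i.val := by
      ext j
      simp [pathGraph_adj]
    rw [← card_neighborFinset_eq_degree, hset, Finset.card_union_of_disjoint]
    · congr 1
      · split_ifs with h
        · subst h
          simp
          intro j
          omega
        · rw [Finset.card_eq_one]
          refine ⟨⟨i + 1, ?_⟩, ?_⟩
          · have := Fin.val_lt_last h
            omega
          · ext j
            simp [Fin.ext_iff, eq_comm]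
      · split_ifs with h
        · subst h
          simp
        · rw [Finset.card_eq_one]
          have : (i : ℕ) ≠ 0 := fun h0 => h (Fin.ext h0)
          refine ⟨⟨i - 1, by omega⟩, ?_⟩
          ext j
          simp [Fin.ext_iff]
          omega
    · rw [Finset.disjoint_left]
      intro j
      simp
      omega
  have h := sum_degrees_eq_twice_card_edges (pathGraph (n + 1))
  simp only [hdeg, Finset.sum_add_distrib, Finset.sum_ite, Finset.filter_ne',
    Finset.sum_const_zero, zero_add, Finset.sum_const, smul_eq_mul, mul_one,
    Finset.mem_univ, Finset.card_erase_of_mem, Finset.card_univ, Fintype.card_fin] at h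
  omega

theorem ncard_edgeSet_boxProd_pathGraph (m n : ℕ) :
    (pathGraph (m + 1) □ pathGraph (n + 1)).edgeSet.ncard = m * (n + 1) + (m + 1) * n := by
  classical
  have h := sum_degrees_eq_twice_card_edges (pathGraph (m + 1) □ pathGraph (n + 1))
  simp only [degree_boxProd, Fintype.sum_prod_type, Finset.sum_add_distrib] at h
  rw [Finset.sum_comm] at h
  simp only [Finset.sum_const, Finset.card_univ, Fintype.card_fin, smul_eq_mul,
    sum_degrees_eq_twice_card_edges, card_edgeFinset_pathGraph] at h
  rw [← coe_edgeFinset, Set.ncard_coe_finset]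
  linarith

theorem badPathInstance_gridRow0_of_badPathTarget {T : Set (Fin p × Fin q)}
    (h : BadPathTarget p fun i => gridTarget T (i, 0)) : BadPathInstance p (gridRow0 p q T) := by
  obtain ⟨heven, hfst, hlast, hpairs⟩ := h
  refine ⟨heven, (gridTarget_eq_one_iff _ _ _).1 hfst, (gridTarget_eq_one_iff _ _ _).1 hlast,
    fun k hk hk' => ?_⟩
  have h := hpairs k hk (by omega)
  dsimp only at h
  have h_odd := gridTarget_eq_one_iff T (2 * k - 1) 0
  rw [h] at h_odd
  exact h_odd.symm.trans (gridTarget_eq_one_iff T (2 * k) 0)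

theorem hasAcyclicTOddOrientation_of_not_badPathInstance_gridRow0 {T : Set (Fin p × Fin q)}
    (hp : 1 ≤ p) (hq : 1 ≤ q) (hP : CondP (pathGraph p □ pathGraph q) T)
    (hnb : ¬ BadPathInstance p (gridRow0 p q T)) :
    HasAcyclicTOddOrientation (pathGraph p □ pathGraph q) T := by
  obtain ⟨m, rfl⟩ := Nat.exists_eq_add_of_le' hp
  obtain ⟨n, rfl⟩ := Nat.exists_eq_add_of_le' hq
  rw [CondP, ncard_edgeSet_boxProd_pathGraph, ← ZMod.natCast_eq_zero_iff_even] at hP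
  refine Realizable.hasAcyclicTOddOrientation ?_
  push_cast at hP
  rcases Nat.even_or_odd (n + 1) with hn | hn
  · have hn' := (ZMod.natCast_eq_zero_iff_even).2 hn
    push_cast at hn'
    refine realizable_gridRect_of_even hn ?_ _
      (mt badPathInstance_gridRow0_of_badPathTarget hnb) ?_
    · obtain ⟨r, hr⟩ := hn
      omega
    · rw [sum_gridTarget]
      push_cast
      grind
  · have hn' := (ZMod.natCast_eq_one_iff_odd).2 hn
    push_cast at hn'
    refine realizable_gridRect_of_odd hn _ ?_
    rw [sum_gridTarget]
    grind

end Transfer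

section Iso

variable {V W : Type*} {G : SimpleGraph V} {H : SimpleGraph W}

theorem CondP.of_iso [Finite V] [Finite W] (φ : G ≃g H) {T : Set V} (h : CondP G T) :
    CondP H (φ '' T) := by
  classical
  have := Fintype.ofFinite V
  have := Fintype.ofFinite W
  rw [CondP] at *
  rwa [Set.ncard_image_of_injective _ φ.injective, ← coe_edgeFinset, Set.ncard_coe_finset,
    ← φ.card_edgeFinset_eq, ← Set.ncard_coe_finset, coe_edgeFinset]

theorem HasAcyclicTOddOrientation.of_iso (φ : G ≃g H) {T : Set V}
    (h : HasAcyclicTOddOrientation H (φ '' T)) : HasAcyclicTOddOrientation G T := by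
  obtain ⟨o, hac, hodd⟩ := h
  refine ⟨⟨fun u v => o.dir (φ u) (φ v), fun u v h => φ.map_adj_iff.1 (o.dir_adj _ _ h),
    fun u v h => o.dir_choice _ _ (φ.map_adj_iff.2 h)⟩, fun v hv => ?_, fun v => ?_⟩
  · exact hac (φ v) (hv.lift φ fun _ _ h => h)
  · have h1 := hodd (φ v)
    rw [φ.injective.mem_set_image] at h1
    rw [← h1, GraphOrientation.indeg, GraphOrientation.indeg,
      ← Set.ncard_image_of_injective _ φ.injective]
    congr! 2
    ext w
    constructor
    · rintro ⟨u, hu, rfl⟩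
      exact hu
    · intro hw
      exact ⟨φ.symm w, by simpa using hw, by simp⟩

/-- The reflection of a grid exchanging the first and last rows. -/
def gridReflect (p q : ℕ) : (pathGraph p □ pathGraph q) ≃g (pathGraph p □ pathGraph q) where
  toEquiv := Equiv.prodCongr (Equiv.refl _) Fin.revPerm
  map_rel_iff' := by
    rintro ⟨i, j⟩ ⟨i', j'⟩
    simp only [boxProd_adj, pathGraph_adj, Equiv.prodCongr_apply, Prod.map, Equiv.refl_apply,
      Fin.revPerm_apply, Fin.rev_inj, Fin.val_rev]
    omega

theorem gridRow0_image_gridReflect {p q : ℕ} (T : Set (Fin p × Fin q)) :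
    gridRow0 p q (gridReflect p q '' T) = gridRowLast p q T := by
  ext i
  simp only [gridRow0, gridRowLast]
  refine exists_congr fun hi => ⟨fun ⟨hj, h⟩ => ⟨by omega, ?_⟩, fun ⟨hj, h⟩ => ⟨by omega, ?_⟩⟩
  · obtain ⟨⟨a, b⟩, hab, heq⟩ := h
    simp only [gridReflect, RelIso.coe_fn_mk, Equiv.prodCongr_apply, Prod.map, Equiv.refl_apply,
      Fin.revPerm_apply, Prod.mk.injEq, Fin.ext_iff, Fin.val_rev] at heq
    convert hab <;> omega
  · refine ⟨_, h, ?_⟩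
    simp only [gridReflect, RelIso.coe_fn_mk, Equiv.prodCongr_apply, Prod.map, Equiv.refl_apply,
      Fin.revPerm_apply, Prod.mk.injEq, Fin.ext_iff, Fin.val_rev]
    exact ⟨trivial, by omega⟩

theorem gridRow0_image_boxProdComm {p q : ℕ} (T : Set (Fin p × Fin q)) :
    gridRow0 q p (boxProdComm (pathGraph p) (pathGraph q) '' T) = gridCol0 p q T := by
  ext j
  simp [gridRow0, gridCol0]
  grind

theorem gridRowLast_image_boxProdComm {p q : ℕ} (T : Set (Fin p × Fin q)) :
    gridRowLast q p (boxProdComm (pathGraph p) (pathGraph q) '' T) = gridColLast p q T := by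
  ext j
  simp [gridRowLast, gridColLast]
  grind

end Iso

theorem hasAcyclicTOddOrientation_of_not_badPathInstance_row {p q : ℕ} {T : Set (Fin p × Fin q)}
    (hp : 1 ≤ p) (hq : 1 ≤ q) (hP : CondP (pathGraph p □ pathGraph q) T)
    (hnb : ¬ BadPathInstance p (gridRow0 p q T) ∨ ¬ BadPathInstance p (gridRowLast p q T)) :
    HasAcyclicTOddOrientation (pathGraph p □ pathGraph q) T := by
  rcases hnb with hnb | hnb
  · exact hasAcyclicTOddOrientation_of_not_badPathInstance_gridRow0 hp hq hP hnb
  · refine .of_iso (gridReflect p q)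
      (hasAcyclicTOddOrientation_of_not_badPathInstance_gridRow0 hp hq (hP.of_iso _) ?_)
    rwa [gridRow0_image_gridReflect]

/-- Lemma: if some boundary path of the grid is not a bad path instance, the grid admits
an acyclic `T`-odd orientation. -/
theorem grid_notBadPath (p q : ℕ) (hp : 1 ≤ p) (hq : 1 ≤ q) (T : Set (Fin p × Fin q))
    (hP : CondP (pathGraph p □ pathGraph q) T)
    (hnb : ¬ BadPathInstance p (gridRow0 p q T) ∨ ¬ BadPathInstance p (gridRowLast p q T) ∨
      ¬ BadPathInstance q (gridCol0 p q T) ∨ ¬ BadPathInstance q (gridColLast p q T)) :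
    HasAcyclicTOddOrientation (pathGraph p □ pathGraph q) T := by
  rw [← or_assoc] at hnb
  rcases hnb with hnb | hnb
  · exact hasAcyclicTOddOrientation_of_not_badPathInstance_row hp hq hP hnb
  · refine .of_iso (boxProdComm _ _)
      (hasAcyclicTOddOrientation_of_not_badPathInstance_row hq hp (hP.of_iso _) ?_)
    rwa [gridRow0_image_boxProdComm, gridRowLast_image_boxProdComm]
end
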